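/- arXiv:2512.13565 — 2 statements merged into one kernel-verified Lean document; each statement's English description precedes it below -/
import Mathlib

section
/- Let Σ be a symmetric positive-definite p×p real matrix with smallest eigenvalue φ_min(Σ) > 0, and let X be a centered Gaussian random vector in ℝ^p with covariance Σ. Then for every u ∈ ℝ^p with ‖u‖₂ = 1, the random variable uᵀT(X)u satisfies ‖uᵀT(X)u‖_{ψ₁} ≤ 4/φ_min(Σ); equivalently, (E|uᵀT(X)u|^k)^{1/k} ≤ 4k/φ_min(Σ) for every real k ≥ 1. -/
open MeasureTheory ProbabilityTheory Real
open scoped Matrix NNReal ENNReal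
noncomputable section

/-- Euclidean norm of a finite real vector. -/
def euclNorm {n : ℕ} (v : Fin n → ℝ) : ℝ := Real.sqrt (∑ i, v i ^ 2)

/-- The second-order Gaussian score `T(x) = Σ⁻¹ x xᵀ Σ⁻¹ − Σ⁻¹`. -/
def score {p : ℕ} (S : Matrix (Fin p) (Fin p) ℝ) (x : Fin p → ℝ) :
    Matrix (Fin p) (Fin p) ℝ :=
  S⁻¹ * Matrix.vecMulVec x x * S⁻¹ - S⁻¹

/-- Under the centred Gaussian law of variance `s`, the function `y ↦ exp (y² / (4 s))` is integrable
with integral `√2`. -/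
lemma integrable_integral_exp_sq_gaussianReal {s : ℝ} (hs : 0 < s) :
    Integrable (fun y => exp (y ^ 2 / (4 * s))) (gaussianReal 0 s.toNNReal) ∧
      ∫ y, exp (y ^ 2 / (4 * s)) ∂(gaussianReal 0 s.toNNReal) = √2 := by
  have hv : s.toNNReal ≠ 0 := by simpa using hs
  have hpdf : ∀ y, gaussianPDFReal 0 s.toNNReal y * exp (y ^ 2 / (4 * s)) =
      (√(2 * π * s))⁻¹ * exp (-(1 / (4 * s)) * y ^ 2) := by
    intro y
    rw [gaussianPDFReal, Real.coe_toNNReal _ hs.le, mul_assoc, ← exp_add]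
    congr 2
    field_simp
    ring
  constructor
  · rw [gaussianReal_of_var_ne_zero _ hv, gaussianPDF_def,
      integrable_withDensity_iff_integrable_smul₀' (by fun_prop) (by simp)]
    simp only [smul_eq_mul, ENNReal.toReal_ofReal (gaussianPDFReal_nonneg _ _ _), hpdf]
    exact (integrable_exp_neg_mul_sq (by positivity)).const_mul _
  · rw [integral_gaussianReal_eq_integral_smul hv]
    simp only [smul_eq_mul, hpdf]
    rw [integral_const_mul, integral_gaussian, ← Real.sqrt_inv, ← Real.sqrt_mul (by positivity)]
    congr 1
    field_simp
    norm_num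

lemma rpow_le_mul_exp_quarter {t k : ℝ} (ht : 0 ≤ t) (hk : 0 < k) :
    t ^ k ≤ (4 * k) ^ k * exp (t / 4 - k) := by
  have h : t ≤ 4 * k * exp (t / (4 * k) - 1) := by
    have := add_one_le_exp (t / (4 * k) - 1)
    rw [sub_add_cancel, div_le_iff₀ (by positivity)] at this
    linarith
  calc t ^ k ≤ (4 * k * exp (t / (4 * k) - 1)) ^ k := rpow_le_rpow ht h hk.le
    _ = (4 * k) ^ k * exp (t / 4 - k) := by
      rw [mul_rpow (by positivity) (exp_pos _).le, ← exp_mul]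
      congr 2
      field_simp

lemma exp_quarter_sub_mul_sqrt_two_le_one {k : ℝ} (hk : 1 ≤ k) : exp (1 / 4 - k) * √2 ≤ 1 := by
  have h2 : √2 ≤ exp (3 / 4) := by
    rw [Real.sqrt_le_left (exp_pos _).le, ← exp_nat_mul]
    have := add_one_le_exp ((2 : ℕ) * (3 / 4) : ℝ)
    norm_num at this ⊢
    linarith
  calc exp (1 / 4 - k) * √2 ≤ exp (-(3 / 4)) * exp (3 / 4) := by
        gcongr
        linarith
    _ = 1 := by rw [← exp_add]; simp

/-- Moment bound for the centred square of a centred Gaussian variable of variance `s`. -/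
lemma integral_abs_sq_sub_rpow_gaussianReal_le {s k : ℝ} (hs : 0 < s) (hk : 1 ≤ k) :
    ∫ y, |y ^ 2 - s| ^ k ∂(gaussianReal 0 s.toNNReal) ≤ (4 * k * s) ^ k := by
  have hk0 : 0 < k := by linarith
  obtain ⟨hint, hval⟩ := integrable_integral_exp_sq_gaussianReal hs
  have hbound : ∀ y : ℝ, |y ^ 2 - s| ^ k ≤
      (4 * k * s) ^ k * exp (1 / 4 - k) * exp (y ^ 2 / (4 * s)) := by
    intro y
    have habs : |y ^ 2 - s| / s ≤ y ^ 2 / s + 1 := by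
      rw [div_le_iff₀ hs, add_mul, div_mul_cancel₀ _ hs.ne', abs_le]
      constructor <;> nlinarith [sq_nonneg y]
    calc |y ^ 2 - s| ^ k = (|y ^ 2 - s| / s) ^ k * s ^ k := by
          rw [← mul_rpow (by positivity) hs.le, div_mul_cancel₀ _ hs.ne']
      _ ≤ ((4 * k) ^ k * exp (|y ^ 2 - s| / s / 4 - k)) * s ^ k := by
          gcongr
          exact rpow_le_mul_exp_quarter (by positivity) hk0
      _ ≤ ((4 * k) ^ k * exp ((y ^ 2 / s + 1) / 4 - k)) * s ^ k := by gcongr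
      _ = (4 * k * s) ^ k * exp (1 / 4 - k) * exp (y ^ 2 / (4 * s)) := by
          rw [mul_rpow (by positivity) hs.le, mul_assoc _ (exp _) (exp _), ← exp_add,
            mul_right_comm]
          congr 2
          field_simp
          ring
  calc ∫ y, |y ^ 2 - s| ^ k ∂(gaussianReal 0 s.toNNReal)
      ≤ ∫ y, (4 * k * s) ^ k * exp (1 / 4 - k) * exp (y ^ 2 / (4 * s))
          ∂(gaussianReal 0 s.toNNReal) :=
        integral_mono_of_nonneg (ae_of_all _ fun y => by positivity) (hint.const_mul _)
          (ae_of_all _ hbound)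
    _ = (4 * k * s) ^ k * (exp (1 / 4 - k) * √2) := by
        rw [integral_const_mul, hval, mul_assoc]
    _ ≤ (4 * k * s) ^ k :=
        mul_le_of_le_one_right (by positivity) (exp_quarter_sub_mul_sqrt_two_le_one hk)

lemma dotProduct_score_mulVec {p : ℕ} {S : Matrix (Fin p) (Fin p) ℝ} (hS : S.IsSymm)
    (u x : Fin p → ℝ) :
    u ⬝ᵥ (score S x).mulVec u = (S⁻¹.mulVec u ⬝ᵥ x) ^ 2 - u ⬝ᵥ S⁻¹.mulVec u := by
  have hvec : u ᵥ* S⁻¹ = S⁻¹ *ᵥ u := by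
    rw [← Matrix.mulVec_transpose, Matrix.transpose_nonsing_inv, hS.eq]
  rw [score, Matrix.sub_mulVec, dotProduct_sub, ← Matrix.mulVec_mulVec, ← Matrix.mulVec_mulVec,
    Matrix.dotProduct_mulVec, hvec, Matrix.vecMulVec_mulVec, dotProduct_comm x]
  simp [sq]

/-- If `Σ` is a symmetric positive-definite `p×p` matrix with smallest
eigenvalue `φmin > 0` (i.e. `φmin ‖v‖² ≤ vᵀ Σ v` for all `v`) and `X` is a centered Gaussian
vector with covariance `Σ` (every linear functional `vᵀX` has law `N(0, vᵀΣv)`), then for every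
unit vector `u`, `‖uᵀ T(X) u‖_{ψ₁} ≤ 4 / φmin`; equivalently,
`(E|uᵀT(X)u|^k)^{1/k} ≤ 4k/φmin` for every real `k ≥ 1`. -/
theorem stmt0 {Ω : Type*} [MeasurableSpace Ω] (μ : Measure Ω) [IsProbabilityMeasure μ]
    {p : ℕ} (S : Matrix (Fin p) (Fin p) ℝ) (hSymm : S.IsSymm) (hPD : S.PosDef)
    (φmin : ℝ) (hφpos : 0 < φmin)
    (hφlb : ∀ v : Fin p → ℝ, φmin * ∑ i, v i ^ 2 ≤ v ⬝ᵥ S.mulVec v)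
    (X : Ω → Fin p → ℝ) (hX : Measurable X)
    (hGauss : ∀ v : Fin p → ℝ,
      Measure.map (fun ω => v ⬝ᵥ X ω) μ = gaussianReal 0 (v ⬝ᵥ S.mulVec v).toNNReal) :
    ∀ u : Fin p → ℝ, euclNorm u = 1 →
      ∀ k : ℝ, 1 ≤ k →
        (∫ ω, |u ⬝ᵥ (score S (X ω)).mulVec u| ^ k ∂μ) ^ k⁻¹ ≤ 4 * k / φmin := by
  intro u hu k hk
  have hk0 : 0 < k := by linarith
  have hu1 : ∑ i, u i ^ 2 = 1 := by rwa [euclNorm, Real.sqrt_eq_one] at hu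
  set v := S⁻¹ *ᵥ u with hv
  set s := u ⬝ᵥ v with hs
  have hSv : S *ᵥ v = u := by
    rw [hv, Matrix.mulVec_mulVec, Matrix.mul_nonsing_inv _ ((Matrix.isUnit_iff_isUnit_det _).1
      hPD.isUnit), Matrix.one_mulVec]
  have hvs : v ⬝ᵥ S *ᵥ v = s := by rw [hSv, dotProduct_comm]
  have hs0 : 0 < s := by
    have hv0 : v ≠ 0 := by
      intro h
      rw [h, Matrix.mulVec_zero] at hSv
      simp [← hSv] at hu1
    simpa [hvs] using hPD.dotProduct_mulVec_pos hv0
  have hsφ : s ≤ 1 / φmin := by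
    have hlow := hφlb v
    have hcs : s ^ 2 ≤ ∑ i, v i ^ 2 := by
      simpa [hu1, hs, dotProduct] using Finset.sum_mul_sq_le_sq_mul_sq Finset.univ u v
    rw [hvs] at hlow
    rw [le_div_iff₀ hφpos]
    nlinarith
  have hmap : ∫ ω, |u ⬝ᵥ (score S (X ω)).mulVec u| ^ k ∂μ =
      ∫ y, |y ^ 2 - s| ^ k ∂(gaussianReal 0 s.toNNReal) := by
    have hmeas : Measurable fun ω => v ⬝ᵥ X ω := by
      unfold dotProduct
      fun_prop
    rw [← hvs, ← hGauss v, integral_map hmeas.aemeasurable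
      (by fun_prop : Measurable _).aestronglyMeasurable, hvs]
    simp only [dotProduct_score_mulVec hSymm, ← hv, ← hs]
  rw [hmap]
  calc (∫ y, |y ^ 2 - s| ^ k ∂(gaussianReal 0 s.toNNReal)) ^ k⁻¹ ≤ ((4 * k * s) ^ k) ^ k⁻¹ :=
        rpow_le_rpow (integral_nonneg fun y => by positivity)
          (integral_abs_sq_sub_rpow_gaussianReal_le hs0 hk) (by positivity)
    _ = 4 * k * s := rpow_rpow_inv (by positivity) hk0.ne'
    _ ≤ 4 * k * (1 / φmin) := by gcongr
    _ = 4 * k / φmin := by ring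
end
end

section
/- Let 0 < β ≤ 1 and C₀ > 0, let S₀ ⊆ {1, …, p} with |S₀| = s ≥ 1, and let G : ℝ^s → ℝ satisfy |G(z) − G(z')| ≤ C₀‖z − z'‖₂^β for all z, z'. Then there exists a constant C > 0 (depending only on C₀, s, β) such that for every m > 0 and all positive integers w, d, there is a function g : ℝ^p → ℝ computed by a ReLU feedforward network of width 3^{s+3}·max{s⌊w^{1/s}⌋, w+1} and depth 12d + 14 + 2s, which depends on x only through the coordinates x_{S₀}, and satisfies sup over x ∈ ℝ^p with x_{S₀} ∈ [−m, m]^s of |G(x_{S₀}) − g(x)| ≤ C · m^β · w^{−2β/s} · d^{−2β/s}. -/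
open scoped Matrix
noncomputable section

/-- Forward pass of a ReLU network with biases: `fwd dims A b l x` is the `l`-th hidden layer,
i.e. `σ(A_l(⋯σ(A_1(x))⋯))`. -/
def fwd (dims : ℕ → ℕ)
    (A : ∀ l, Matrix (Fin (dims (l + 1))) (Fin (dims l)) ℝ)
    (b : ∀ l, Fin (dims (l + 1)) → ℝ) :
    (l : ℕ) → (Fin (dims 0) → ℝ) → Fin (dims l) → ℝ
  | 0 => fun x => x
  | (l + 1) => fun x i => max (((A l).mulVec (fwd dims A b l x) + b l) i) 0

/-- `IsReluNet Wd D g`: `g : ℝ^p → ℝ` is computed by a ReLU feedforward network of width `Wd`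
and depth `D`, i.e. `g = A_{D+1} ∘ σ ∘ A_D ∘ ⋯ ∘ σ ∘ A_1` for affine maps `A_1, …, A_{D+1}`,
with `D` hidden layers each of dimension at most `Wd`. -/
def IsReluNet {p : ℕ} (Wd D : ℕ) (g : (Fin p → ℝ) → ℝ) : Prop :=
  ∃ dims : ℕ → ℕ, ∃ h0 : dims 0 = p, ∃ hD : dims (D + 1) = 1,
    (∀ l, 1 ≤ l → l ≤ D → dims l ≤ Wd) ∧
    ∃ (A : ∀ l, Matrix (Fin (dims (l + 1))) (Fin (dims l)) ℝ)
      (b : ∀ l, Fin (dims (l + 1)) → ℝ),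
      ∀ x : Fin p → ℝ,
        g x = ((A D).mulVec (fwd dims A b D (fun j => x (Fin.cast h0 j))) + b D)
            (Fin.cast hD.symm ⟨0, Nat.one_pos⟩)

/-- The subvector `x_{S}` of the coordinates of `x` indexed by `S` (in increasing order). -/
def subvec {p s : ℕ} (S : Finset (Fin p)) (hs : S.card = s) (x : Fin p → ℝ) :
    Fin s → ℝ :=
  fun i => x ((S.orderIsoOfFin hs i : S) : Fin p)

/-- The span of a set of real functions together with the constants. -/
def affSpan {Ω : Type*} (S : Set (Ω → ℝ)) : Submodule ℝ (Ω → ℝ) :=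
  Submodule.span ℝ (insert 1 S)

/-- The positive part of a real function. -/
def reluFn {Ω : Type*} (f : Ω → ℝ) : Ω → ℝ := fun ω => max (f ω) 0

/-- The indicator of the set where a function is nonnegative. -/
def nonnegInd {Ω : Type*} (f : Ω → ℝ) : Ω → ℝ := fun ω => if 0 ≤ f ω then 1 else 0

/-- `Layered B W D S`: all functions in `S` are affine combinations of the units of the last layer
of a single ReLU network with inputs `B` and `D` hidden layers of width at most `W`. -/
def Layered {Ω : Type*} (B : Set (Ω → ℝ)) (W : ℕ) : ℕ → Set (Ω → ℝ) → Prop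
  | 0, S => S ⊆ affSpan B
  | D + 1, S => ∃ U : List (Ω → ℝ), U.length ≤ W ∧ Layered B W D {f | f ∈ U} ∧
      S ⊆ affSpan (reluFn '' {f | f ∈ U})

section Layered

variable {Ω : Type*} {B S S' : Set (Ω → ℝ)} {W D : ℕ}

lemma subset_affSpan : S ⊆ affSpan S :=
  (Set.subset_insert _ _).trans Submodule.subset_span

lemma const_mem_affSpan (c : ℝ) : (fun _ => c) ∈ affSpan S := by
  have h : (1 : Ω → ℝ) ∈ affSpan S := Submodule.subset_span (Set.mem_insert _ _)
  have := (affSpan S).smul_mem c h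
  convert this using 1
  ext; simp

lemma affSpan_le (h : S' ⊆ affSpan S) : affSpan S' ≤ affSpan S :=
  Submodule.span_le.2 (Set.insert_subset (const_mem_affSpan 1) h)

lemma affSpan_mono (h : S' ⊆ S) : affSpan S' ≤ affSpan S :=
  affSpan_le (h.trans subset_affSpan)

lemma Layered.mono (h : Layered B W D S) (hS : S' ⊆ affSpan S) : Layered B W D S' := by
  cases D with
  | zero => exact hS.trans (affSpan_le h)
  | succ D =>
    obtain ⟨U, h1, h2, h3⟩ := h
    exact ⟨U, h1, h2, hS.trans (affSpan_le h3)⟩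

lemma Layered.relu (h : Layered B W D S) (U : List (Ω → ℝ)) (hU : ∀ u ∈ U, u ∈ affSpan S)
    (hW : U.length ≤ W) : Layered B W (D + 1) (reluFn '' {f | f ∈ U}) :=
  ⟨U, hW, h.mono hU, subset_affSpan⟩

lemma Layered.mono_input {B' : Set (Ω → ℝ)} (hB : B ⊆ affSpan B') (h : Layered B W D S) :
    Layered B' W D S := by
  induction D generalizing S with
  | zero => exact h.trans (affSpan_le hB)
  | succ D ih =>
    obtain ⟨U, h1, h2, h3⟩ := h
    exact ⟨U, h1, ih h2, h3⟩

lemma reluFn_eq_self {f : Ω → ℝ} (hf : ∀ ω, 0 ≤ f ω) : reluFn f = f :=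
  funext fun ω => max_eq_left (hf ω)

lemma reluFn_sub_reluFn_neg (g : Ω → ℝ) : reluFn g - reluFn (-g) = g := by
  ext ω
  simp only [reluFn, Pi.sub_apply, Pi.neg_apply]
  rcases le_total 0 (g ω) with h | h
  · rw [max_eq_left h, max_eq_right (by linarith)]; ring
  · rw [max_eq_right h, max_eq_left (by linarith)]; ring

lemma Layered.pad {g : Ω → ℝ} (hW : 2 ≤ W) (h : Layered B W D {g}) (n : ℕ) :
    Layered B W (D + n) {g} := by
  induction n with
  | zero => exact h
  | succ n ih =>
    have hg : g ∈ affSpan ({g} : Set (Ω → ℝ)) := subset_affSpan rfl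
    refine (ih.relu [g, -g] (by simpa using hg) (by simpa using hW)).mono ?_
    rw [Set.singleton_subset_iff]
    have h1 : reluFn g ∈ affSpan (reluFn '' {f | f ∈ [g, -g]}) :=
      subset_affSpan ⟨g, by simp, rfl⟩
    have h2 : reluFn (-g) ∈ affSpan (reluFn '' {f | f ∈ [g, -g]}) :=
      subset_affSpan ⟨-g, by simp, rfl⟩
    have := sub_mem h1 h2
    rwa [reluFn_sub_reluFn_neg] at this

lemma Layered.parallel {κ : Type*} (l : List κ) (T : κ → Set (Ω → ℝ))
    (h : ∀ k ∈ l, Layered B W D (T k)) :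
    Layered B (l.length * W) D {f | ∃ k ∈ l, f ∈ T k} := by
  induction D generalizing T with
  | zero =>
    rintro f ⟨k, hk, hf⟩
    exact h k hk hf
  | succ D ih =>
    have : ∀ k, ∃ U : List (Ω → ℝ), k ∈ l → U.length ≤ W ∧ Layered B W D {f | f ∈ U} ∧
      T k ⊆ affSpan (reluFn '' {f | f ∈ U}) := fun k => by
        by_cases hk : k ∈ l
        · obtain ⟨U, hU⟩ := h k hk
          exact ⟨U, fun _ => hU⟩
        · exact ⟨[], fun h => absurd h hk⟩
    choose U hU using this
    refine ⟨l.flatMap U, ?_, ?_, ?_⟩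
    · rw [List.length_flatMap]
      have := List.sum_le_card_nsmul (l.map fun k => (U k).length) W (by
        intro x hx
        obtain ⟨k, hk, rfl⟩ := List.mem_map.1 hx
        exact (hU k hk).1)
      simpa using this
    · refine (ih (fun k => {f | f ∈ U k}) fun k hk => (hU k hk).2.1).mono ?_
      intro f hf
      refine subset_affSpan ?_
      simpa [List.mem_flatMap] using hf
    · rintro f ⟨k, hk, hf⟩
      refine affSpan_mono (Set.image_mono ?_) ((hU k hk).2.2 hf)
      intro g hg
      exact List.mem_flatMap.2 ⟨k, hk, hg⟩

lemma map_funLeft_affSpan {X : Type*} (h : Ω → X) (T : Set (X → ℝ)) :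
    (affSpan T).map (LinearMap.funLeft ℝ ℝ h) = affSpan ((fun f => f ∘ h) '' T) := by
  rw [affSpan, affSpan, Submodule.map_span, Set.image_insert_eq]
  rfl

lemma reluFn_image_comp {X : Type*} (h : Ω → X) (T : Set (X → ℝ)) :
    (fun f => f ∘ h) '' (reluFn '' T) = reluFn '' ((fun f => f ∘ h) '' T) := by
  rw [Set.image_image, Set.image_image]
  rfl

/-- A network evaluated along `h` extends to a network on the whole target of `h`. -/
lemma Layered.exists_extension {X : Type*} (h : Ω → X) {B : Set (X → ℝ)}
    (hL : Layered ((fun f => f ∘ h) '' B) W D S) :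
    ∃ T : Set (X → ℝ), Layered B W D T ∧ S ⊆ (fun f => f ∘ h) '' T := by
  induction D generalizing S with
  | zero =>
    refine ⟨affSpan B, subset_rfl, fun f hf => ?_⟩
    have := hL hf
    rw [SetLike.mem_coe, ← map_funLeft_affSpan] at this
    exact this
  | succ D ih =>
    obtain ⟨U, h1, h2, h3⟩ := hL
    obtain ⟨T, hT, hUT⟩ := ih h2
    have : ∀ f ∈ U, ∃ g : X → ℝ, g ∈ T ∧ g ∘ h = f := fun f hf => hUT hf
    choose! e he using this
    have hU : (fun f => f ∘ h) '' {f | f ∈ U.map e} = {f | f ∈ U} := by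
      ext f
      constructor
      · rintro ⟨g, hg, rfl⟩
        obtain ⟨f, hf, rfl⟩ := List.mem_map.1 hg
        have := (he f hf).2
        simpa [this] using hf
      · exact fun hf => ⟨e f, List.mem_map.2 ⟨f, hf, rfl⟩, (he f hf).2⟩
    refine ⟨affSpan (reluFn '' {f | f ∈ U.map e}), ⟨U.map e, by simpa using h1,
      hT.mono ?_, subset_rfl⟩, fun f hf => ?_⟩
    · intro g hg
      obtain ⟨f, hf, rfl⟩ := List.mem_map.1 hg
      exact subset_affSpan (he f hf).1
    · have := h3 hf
      rw [SetLike.mem_coe, ← hU, ← reluFn_image_comp, ← map_funLeft_affSpan] at this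
      exact this

lemma Layered.comp {X : Type*} (h : Ω → X) {B : Set (X → ℝ)} {T : Set (X → ℝ)}
    (hL : Layered B W D T) :
    Layered ((fun f => f ∘ h) '' B) W D ((fun f => f ∘ h) '' T) := by
  induction D generalizing T with
  | zero =>
    rintro _ ⟨f, hf, rfl⟩
    rw [SetLike.mem_coe, ← map_funLeft_affSpan]
    exact ⟨f, hL hf, rfl⟩
  | succ D ih =>
    obtain ⟨U, h1, h2, h3⟩ := hL
    have hU : {f | f ∈ U.map fun f => f ∘ h} = (fun f => f ∘ h) '' {f | f ∈ U} := by
      ext f; simp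
    refine ⟨U.map fun f => f ∘ h, by simpa using h1, ?_, ?_⟩
    · rw [hU]; exact ih h2
    · rintro _ ⟨f, hf, rfl⟩
      rw [hU, ← reluFn_image_comp, SetLike.mem_coe, ← map_funLeft_affSpan]
      exact ⟨f, h3 hf, rfl⟩

/-- One layer computes the nonnegativity indicators of functions with a gap below zero. -/
lemma Layered.threshold (h : Layered B W D S) (T C : List (Ω → ℝ))
    (hT : ∀ t ∈ T, t ∈ affSpan S) (hgap : ∀ t ∈ T, ∀ ω, 0 ≤ t ω ∨ t ω ≤ -(1 / 4))
    (hC : ∀ c ∈ C, c ∈ affSpan S) (hC0 : ∀ c ∈ C, ∀ ω, 0 ≤ c ω)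
    (hW : 2 * T.length + C.length ≤ W) :
    Layered B W (D + 1) (nonnegInd '' {t | t ∈ T} ∪ {c | c ∈ C}) := by
  have h4 : ∀ t ∈ T, (fun ω => 4 * t ω) ∈ affSpan S := fun t ht =>
    (affSpan S).smul_mem 4 (hT t ht)
  refine (h.relu (T.map (fun t ω => 4 * t ω + 1) ++ T.map (fun t ω => 4 * t ω) ++ C) ?_ ?_).mono ?_
  · intro u hu
    simp only [List.mem_append, List.mem_map] at hu
    rcases hu with (⟨t, ht, rfl⟩ | ⟨t, ht, rfl⟩) | hu
    · exact add_mem (h4 t ht) (const_mem_affSpan 1)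
    · exact h4 t ht
    · exact hC u hu
  · simp only [List.length_append, List.length_map]; omega
  · rintro _ (⟨t, ht, rfl⟩ | hf)
    · have : nonnegInd t = reluFn (fun ω => 4 * t ω + 1) - reluFn (fun ω => 4 * t ω) := by
        ext ω
        simp only [nonnegInd, reluFn, Pi.sub_apply]
        rcases hgap t ht ω with h0 | h0
        · rw [if_pos h0, max_eq_left (by linarith), max_eq_left (by linarith)]; ring
        · rw [if_neg (by linarith), max_eq_right (by linarith), max_eq_right (by linarith)]; ring
      rw [this]
      refine sub_mem (subset_affSpan ⟨_, ?_, rfl⟩) (subset_affSpan ⟨_, ?_, rfl⟩)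
      · exact List.mem_append_left _ (List.mem_append_left _ (List.mem_map.2 ⟨t, ht, rfl⟩))
      · exact List.mem_append_left _ (List.mem_append_right _ (List.mem_map.2 ⟨t, ht, rfl⟩))
    · exact subset_affSpan ⟨_, List.mem_append_right _ hf, reluFn_eq_self (hC0 _ hf)⟩

end Layered

section Lookup

variable {Ω : Type*} {B S : Set (Ω → ℝ)} {W D : ℕ}

lemma nonneg_or_le_of_int {f : Ω → ℝ} (hf : ∀ ω, ∃ z : ℤ, f ω = z) (ω : Ω) :
    0 ≤ f ω ∨ f ω ≤ -(1 / 4) := by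
  obtain ⟨z, hz⟩ := hf ω
  rw [hz]
  rcases le_or_gt 0 z with h | h
  · left; exact_mod_cast h
  · right
    have : (z : ℝ) ≤ -1 := by exact_mod_cast Int.le_sub_one_of_lt h
    linarith

lemma nat_div_eq_sum_ite (k q n : ℕ) (hq : 0 < q) (hn : k / q ≤ n) :
    k / q = ∑ j ∈ Finset.range n, if (j + 1) * q ≤ k then 1 else 0 := by
  have : ∀ j, ((j + 1) * q ≤ k) ↔ j < k / q := fun j => by
    rw [← Nat.le_div_iff_mul_le hq]; exact Iff.rfl
  simp only [this]
  rw [Finset.sum_ite, Finset.sum_const_zero, add_zero, Finset.sum_const, smul_eq_mul, mul_one]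
  have h2 : (Finset.range n).filter (fun j => j < k / q) = Finset.range (k / q) := by
    ext j; simp; omega
  rw [h2, Finset.card_range]

section Digits

variable {s : ℕ} (k : Fin s → Ω → ℕ) (r : Fin s → Ω → ℝ)

/-- The functions `k i + r i`. -/
def perturbed : Set (Ω → ℝ) := Set.range fun i ω => (k i ω : ℝ) + r i ω

lemma nonneg_or_le_of_perturbed (hr : ∀ i ω, 0 ≤ r i ω ∧ r i ω ≤ 3 / 4) (i : Fin s) (c : ℕ)
    (ω : Ω) : 0 ≤ (k i ω : ℝ) + r i ω - c ∨ (k i ω : ℝ) + r i ω - c ≤ -(1 / 4) := by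
  have := hr i ω
  rcases le_or_gt c (k i ω) with h | h
  · left
    have : (c : ℝ) ≤ k i ω := by exact_mod_cast h
    linarith
  · right
    have : (k i ω : ℝ) + 1 ≤ c := by exact_mod_cast h
    linarith

lemma nonnegInd_perturbed (hr : ∀ i ω, 0 ≤ r i ω ∧ r i ω ≤ 3 / 4) (i : Fin s) (c : ℕ) :
    nonnegInd (fun ω => (k i ω : ℝ) + r i ω - c) = fun ω => if c ≤ k i ω then 1 else 0 := by
  ext ω
  have := hr i ω
  rw [nonnegInd]
  refine if_congr ?_ rfl rfl
  constructor
  · intro h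
    by_contra! h'
    have : (k i ω : ℝ) + 1 ≤ c := by exact_mod_cast h'
    linarith
  · intro h
    have : (c : ℝ) ≤ k i ω := by exact_mod_cast h
    linarith

lemma perturbed_mod_mem (q : ℕ) (i : Fin s) {V : Submodule ℝ (Ω → ℝ)}
    (h1 : (fun ω => (k i ω : ℝ) + r i ω) ∈ V) (h2 : (fun ω => ((k i ω / q : ℕ) : ℝ)) ∈ V) :
    (fun ω => ((k i ω % q : ℕ) : ℝ) + r i ω) ∈ V := by
  convert V.sub_mem h1 (V.smul_mem (q : ℝ) h2) using 1
  ext ω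
  have : (k i ω : ℝ) = q * (k i ω / q : ℕ) + (k i ω % q : ℕ) := by
    exact_mod_cast (Nat.div_add_mod (k i ω) q).symm
  simp only [Pi.sub_apply, Pi.smul_apply, smul_eq_mul]
  linarith

/-- Division with remainder in one wide layer. -/
lemma Layered.divMod_wide (hr : ∀ i ω, 0 ≤ r i ω ∧ r i ω ≤ 3 / 4) (q n : ℕ) (hq : 0 < q)
    (hn : ∀ i ω, k i ω / q ≤ n) (C : List (Ω → ℝ)) (hC0 : ∀ c ∈ C, ∀ ω, 0 ≤ c ω)
    (h : Layered B W D (perturbed k r ∪ {c | c ∈ C}))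
    (hW : 2 * (s * n) + s + C.length ≤ W) :
    Layered B W (D + 1) (perturbed (fun i ω => k i ω % q) r ∪
      {c | c ∈ (List.finRange s).map (fun i ω => ((k i ω / q : ℕ) : ℝ)) ++ C}) := by
  set T : List (Ω → ℝ) := (List.finRange s).flatMap fun i => (List.range n).map fun j ω =>
    (k i ω : ℝ) + r i ω - ((j + 1) * q : ℕ) with hT
  set C' : List (Ω → ℝ) := (List.finRange s).map (fun i ω => (k i ω : ℝ) + r i ω) ++ C with hC'
  have hTm : ∀ t, t ∈ T ↔ ∃ i, ∃ j < n, (fun ω => (k i ω : ℝ) + r i ω - ((j + 1) * q : ℕ)) = t := by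
    intro t; simp only [hT, List.mem_flatMap, List.mem_finRange, true_and, List.mem_map,
      List.mem_range]
  have hkr : ∀ i, (fun ω => (k i ω : ℝ) + r i ω) ∈ affSpan (perturbed k r ∪ {c | c ∈ C}) :=
    fun i => subset_affSpan (Or.inl ⟨i, rfl⟩)
  refine (h.threshold T C' ?_ ?_ ?_ ?_ ?_).mono ?_
  · intro t ht
    obtain ⟨i, j, -, rfl⟩ := (hTm t).1 ht
    exact sub_mem (hkr i) (const_mem_affSpan _)
  · intro t ht ω
    obtain ⟨i, j, -, rfl⟩ := (hTm t).1 ht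
    exact nonneg_or_le_of_perturbed k r hr i _ ω
  · intro c hc
    rcases List.mem_append.1 hc with hc | hc
    · obtain ⟨i, -, rfl⟩ := List.mem_map.1 hc
      exact hkr i
    · exact subset_affSpan (Or.inr hc)
  · intro c hc ω
    rcases List.mem_append.1 hc with hc | hc
    · obtain ⟨i, -, rfl⟩ := List.mem_map.1 hc
      have := (hr i ω).1
      positivity
    · exact hC0 c hc ω
  · simp [hT, hC', List.length_flatMap]; omega
  · set V := affSpan (nonnegInd '' {t | t ∈ T} ∪ {c | c ∈ C'})
    have hdiv : ∀ i, (fun ω => ((k i ω / q : ℕ) : ℝ)) ∈ V := by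
      intro i
      have : (fun ω => ((k i ω / q : ℕ) : ℝ)) = ∑ j ∈ Finset.range n,
          nonnegInd (fun ω => (k i ω : ℝ) + r i ω - ((j + 1) * q : ℕ)) := by
        ext ω
        simp only [nonnegInd_perturbed k r hr, Finset.sum_apply]
        rw [nat_div_eq_sum_ite (k i ω) q n hq (hn i ω)]
        push_cast
        rfl
      rw [this]
      refine sum_mem fun j hj => subset_affSpan (Or.inl ⟨_, ?_, rfl⟩)
      exact (hTm _).2 ⟨i, j, Finset.mem_range.1 hj, rfl⟩
    rintro _ (⟨i, rfl⟩ | hc)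
    · refine perturbed_mod_mem k r q i (subset_affSpan (Or.inr ?_)) (hdiv i)
      exact List.mem_append_left _ (List.mem_map.2 ⟨i, List.mem_finRange i, rfl⟩)
    · rcases List.mem_append.1 hc with hc | hc
      · obtain ⟨i, -, rfl⟩ := List.mem_map.1 hc
        exact hdiv i
      · exact subset_affSpan (Or.inr (List.mem_append_right _ hc))

/-- Division with remainder in many narrow layers. -/
lemma Layered.divMod_deep (hr : ∀ i ω, 0 ≤ r i ω ∧ r i ω ≤ 3 / 4) (q n : ℕ) (hq : 0 < q)
    (hn : ∀ i ω, k i ω / q ≤ n) (C : List (Ω → ℝ)) (hC0 : ∀ c ∈ C, ∀ ω, 0 ≤ c ω)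
    (h : Layered B W D (perturbed k r ∪ {c | c ∈ C}))
    (hW : 4 * s + C.length ≤ W) :
    Layered B W (D + n) (perturbed (fun i ω => k i ω % q) r ∪
      {c | c ∈ (List.finRange s).map (fun i ω => ((k i ω / q : ℕ) : ℝ)) ++ C}) := by
  let acc : ℕ → Fin s → Ω → ℝ := fun m i ω =>
    ∑ j ∈ Finset.range m, if (j + 1) * q ≤ k i ω then 1 else 0
  have key : ∀ m, Layered B W (D + m)
      (perturbed k r ∪ {c | c ∈ (List.finRange s).map (acc m) ++ C}) := by
    intro m
    induction m with
    | zero =>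
      refine h.mono ?_
      rintro _ (⟨i, rfl⟩ | hc)
      · exact subset_affSpan (Or.inl ⟨i, rfl⟩)
      · rcases List.mem_append.1 hc with hc | hc
        · obtain ⟨i, -, rfl⟩ := List.mem_map.1 hc
          have : acc 0 i = fun _ => 0 := by ext; simp [acc]
          rw [this]
          exact const_mem_affSpan 0
        · exact subset_affSpan (Or.inr hc)
    | succ m ih =>
      set S₁ := perturbed k r ∪ {c | c ∈ (List.finRange s).map (acc m) ++ C} with hS₁
      set T : List (Ω → ℝ) := (List.finRange s).map fun i ω =>
        (k i ω : ℝ) + r i ω - ((m + 1) * q : ℕ) with hT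
      set C' : List (Ω → ℝ) := (List.finRange s).map (fun i ω => (k i ω : ℝ) + r i ω) ++
        ((List.finRange s).map (acc m) ++ C) with hC'
      have hkr : ∀ i, (fun ω => (k i ω : ℝ) + r i ω) ∈ affSpan S₁ :=
        fun i => subset_affSpan (Or.inl ⟨i, rfl⟩)
      refine (ih.threshold T C' ?_ ?_ ?_ ?_ ?_).mono ?_
      · intro t ht
        obtain ⟨i, -, rfl⟩ := List.mem_map.1 ht
        exact sub_mem (hkr i) (const_mem_affSpan _)
      · intro t ht ω
        obtain ⟨i, -, rfl⟩ := List.mem_map.1 ht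
        exact nonneg_or_le_of_perturbed k r hr i _ ω
      · intro c hc
        rcases List.mem_append.1 hc with hc | hc
        · obtain ⟨i, -, rfl⟩ := List.mem_map.1 hc
          exact hkr i
        · exact subset_affSpan (Or.inr hc)
      · intro c hc ω
        rcases List.mem_append.1 hc with hc | hc
        · obtain ⟨i, -, rfl⟩ := List.mem_map.1 hc
          have := (hr i ω).1
          positivity
        · rcases List.mem_append.1 hc with hc | hc
          · obtain ⟨i, -, rfl⟩ := List.mem_map.1 hc
            exact Finset.sum_nonneg fun j _ => by split_ifs <;> norm_num
          · exact hC0 c hc ω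
      · simp [hT, hC']; omega
      · rintro _ (⟨i, rfl⟩ | hc)
        · refine subset_affSpan (Or.inr (List.mem_append_left _ ?_))
          exact List.mem_map.2 ⟨i, List.mem_finRange i, rfl⟩
        · rcases List.mem_append.1 hc with hc | hc
          · obtain ⟨i, -, rfl⟩ := List.mem_map.1 hc
            have : acc (m + 1) i = acc m i +
                nonnegInd (fun ω => (k i ω : ℝ) + r i ω - ((m + 1) * q : ℕ)) := by
              ext ω
              simp only [nonnegInd_perturbed k r hr, acc, Finset.sum_range_succ, Pi.add_apply]
            rw [this]
            refine add_mem (subset_affSpan (Or.inr ?_)) (subset_affSpan (Or.inl ⟨_, ?_, rfl⟩))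
            · exact List.mem_append_right _ (List.mem_append_left _
                (List.mem_map.2 ⟨i, List.mem_finRange i, rfl⟩))
            · exact List.mem_map.2 ⟨i, List.mem_finRange i, rfl⟩
          · exact subset_affSpan (Or.inr (List.mem_append_right _ (List.mem_append_right _ hc)))
  refine (key n).mono ?_
  have hdiv : ∀ i, (fun ω => ((k i ω / q : ℕ) : ℝ)) = acc n i := by
    intro i
    ext ω
    rw [nat_div_eq_sum_ite (k i ω) q n hq (hn i ω)]
    push_cast
    rfl
  have hmem : ∀ i, (fun ω => ((k i ω / q : ℕ) : ℝ)) ∈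
      affSpan (perturbed k r ∪ {c | c ∈ (List.finRange s).map (acc n) ++ C}) := fun i =>
    subset_affSpan (Or.inr (List.mem_append_left _
      (List.mem_map.2 ⟨i, List.mem_finRange i, (hdiv i).symm⟩)))
  rintro _ (⟨i, rfl⟩ | hc)
  · exact perturbed_mod_mem k r q i (subset_affSpan (Or.inl ⟨i, rfl⟩)) (hmem i)
  · rcases List.mem_append.1 hc with hc | hc
    · obtain ⟨i, -, rfl⟩ := List.mem_map.1 hc
      exact hmem i
    · exact subset_affSpan (Or.inr (List.mem_append_right _ hc))

end Digits

lemma nonnegInd_natCast_sub (a : Ω → ℕ) (c : ℕ) :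
    nonnegInd (fun ω => (a ω : ℝ) - c) = fun ω => if c ≤ a ω then 1 else 0 := by
  ext ω
  simp [nonnegInd]

lemma ite_eq_eq_sub (a : Ω → ℕ) (c : ℕ) :
    (fun ω => if a ω = c then (1 : ℝ) else 0) = nonnegInd (fun ω => (a ω : ℝ) - c) -
      nonnegInd (fun ω => (a ω : ℝ) - (c + 1 : ℕ)) := by
  ext ω
  rw [nonnegInd_natCast_sub, nonnegInd_natCast_sub, Pi.sub_apply]
  rcases lt_trichotomy (a ω) c with h | h | h
  · simp [h.ne, h.not_ge, show ¬ (c + 1 ≤ a ω) by omega]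
  · simp [h]
  · simp [h.ne', h.le, show c + 1 ≤ a ω by omega]

/-- Table lookup: a `N × N × m` table is read in `2 * m` layers of width `O(N)`. -/
lemma Layered.lookup (V : ℕ → ℕ → ℕ → ℝ) (hV : ∀ i j l, 0 ≤ V i j l) (N : ℕ)
    (a₁ a₂ l : Ω → ℕ) (h₁ : ∀ ω, a₁ ω < N) (h₂ : ∀ ω, a₂ ω < N) (C : List (Ω → ℝ))
    (hC0 : ∀ c ∈ C, ∀ ω, 0 ≤ c ω)
    (ha₁ : (fun ω => (a₁ ω : ℝ)) ∈ C) (ha₂ : (fun ω => (a₂ ω : ℝ)) ∈ C)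
    (hl : (fun ω => (l ω : ℝ)) ∈ C)
    (h : Layered B W D {c | c ∈ C}) (hW : 4 * N + 9 + C.length ≤ W) (L : ℕ)
    (hL : ∀ ω, l ω < L) :
    Layered B W (D + 2 * L) {c | c ∈ (fun ω => V (a₁ ω) (a₂ ω) (l ω)) :: C} := by
  let acc : ℕ → Ω → ℝ := fun m ω => if l ω < m then V (a₁ ω) (a₂ ω) (l ω) else 0
  have hacc : ∀ m ω, 0 ≤ acc m ω := fun m ω => by
    simp only [acc]; split_ifs
    exacts [hV _ _ _, le_rfl]
  have key : ∀ m, Layered B W (D + 2 * m) {c | c ∈ acc m :: C} := by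
    intro m
    induction m with
    | zero =>
      refine h.mono ?_
      intro c hc
      rcases List.mem_cons.1 hc with rfl | hc
      · have : acc 0 = fun _ => 0 := by ext; simp [acc]
        rw [this]
        exact const_mem_affSpan 0
      · exact subset_affSpan hc
    | succ m ih =>
      have hC' : ∀ c ∈ acc m :: C, ∀ ω, 0 ≤ c ω := by
        intro c hc
        rcases List.mem_cons.1 hc with rfl | hc
        · exact hacc m
        · exact hC0 c hc
      set T : List (Ω → ℝ) := (List.range (N + 1)).map (fun (c : ℕ) ω => (a₁ ω : ℝ) - c) ++
        (List.range (N + 1)).map (fun (c : ℕ) ω => (a₂ ω : ℝ) - c) ++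
        [fun ω => (l ω : ℝ) - m, fun ω => (l ω : ℝ) - (m + 1 : ℕ)] with hT
      have hTm : ∀ t ∈ T, ∃ a : Ω → ℕ, (fun ω => (a ω : ℝ)) ∈ C ∧ ∃ c : ℕ,
          t = fun ω => (a ω : ℝ) - c := by
        intro t ht
        simp only [hT, List.mem_append, List.mem_map, List.mem_cons, List.not_mem_nil,
          or_false] at ht
        rcases ht with (⟨c, -, rfl⟩ | ⟨c, -, rfl⟩) | rfl | rfl
        · exact ⟨a₁, ha₁, c, rfl⟩
        · exact ⟨a₂, ha₂, c, rfl⟩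
        · exact ⟨l, hl, m, rfl⟩
        · exact ⟨l, hl, m + 1, rfl⟩
      have hA := ih.threshold T (acc m :: C) (by
          intro t ht
          obtain ⟨a, ha, c, rfl⟩ := hTm t ht
          exact sub_mem (subset_affSpan (List.mem_cons_of_mem _ ha)) (const_mem_affSpan _))
        (by
          intro t ht
          obtain ⟨a, ha, c, rfl⟩ := hTm t ht
          exact nonneg_or_le_of_int fun ω => ⟨(a ω : ℤ) - c, by push_cast; rfl⟩)
        (fun c hc => subset_affSpan hc) hC' (by simp [hT]; omega)
      set V₁ := affSpan (nonnegInd '' {t | t ∈ T} ∪ {c | c ∈ acc m :: C})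
      have e₁ : ∀ c < N, (fun ω => if a₁ ω = c then (1 : ℝ) else 0) ∈ V₁ := by
        intro c hc
        rw [ite_eq_eq_sub]
        refine sub_mem (subset_affSpan (Or.inl ⟨_, ?_, rfl⟩)) (subset_affSpan (Or.inl ⟨_, ?_, rfl⟩))
        · exact List.mem_append_left _ (List.mem_append_left _
            (List.mem_map.2 ⟨c, List.mem_range.2 (by omega), rfl⟩))
        · exact List.mem_append_left _ (List.mem_append_left _
            (List.mem_map.2 ⟨c + 1, List.mem_range.2 (by omega), rfl⟩))
      have e₂ : ∀ c < N, (fun ω => if a₂ ω = c then (1 : ℝ) else 0) ∈ V₁ := by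
        intro c hc
        rw [ite_eq_eq_sub]
        refine sub_mem (subset_affSpan (Or.inl ⟨_, ?_, rfl⟩)) (subset_affSpan (Or.inl ⟨_, ?_, rfl⟩))
        · exact List.mem_append_left _ (List.mem_append_right _
            (List.mem_map.2 ⟨c, List.mem_range.2 (by omega), rfl⟩))
        · exact List.mem_append_left _ (List.mem_append_right _
            (List.mem_map.2 ⟨c + 1, List.mem_range.2 (by omega), rfl⟩))
      have e₃ : (fun ω => if l ω = m then (1 : ℝ) else 0) ∈ V₁ := by
        rw [ite_eq_eq_sub]
        refine sub_mem (subset_affSpan (Or.inl ⟨_, ?_, rfl⟩)) (subset_affSpan (Or.inl ⟨_, ?_, rfl⟩))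
        · exact List.mem_append_right _ (by simp)
        · exact List.mem_append_right _ (by simp)
      set b : ℝ := ∑ i ∈ Finset.range N, ∑ j ∈ Finset.range N, V i j m with hb
      have hVb : ∀ i < N, ∀ j < N, V i j m ≤ b := fun i hi j hj =>
        (Finset.single_le_sum (f := fun j => V i j m) (fun j _ => hV i j m)
          (Finset.mem_range.2 hj)).trans
        (Finset.single_le_sum (f := fun i => ∑ j ∈ Finset.range N, V i j m)
          (fun i _ => Finset.sum_nonneg fun j _ => hV i j m) (Finset.mem_range.2 hi))
      set u : ℕ → Ω → ℝ := fun i => (∑ j ∈ Finset.range N,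
        V i j m • fun ω => if a₂ ω = j then (1 : ℝ) else 0) +
        b • (fun ω => if a₁ ω = i then (1 : ℝ) else 0) +
        b • (fun ω => if l ω = m then (1 : ℝ) else 0) - fun _ => 2 * b with hu
      have hu' : ∀ i ω, u i ω = V i (a₂ ω) m + b * (if a₁ ω = i then (1 : ℝ) else 0) +
          b * (if l ω = m then (1 : ℝ) else 0) - 2 * b := by
        intro i ω
        simp only [hu, Pi.sub_apply, Pi.add_apply, Pi.smul_apply, Finset.sum_apply, smul_eq_mul]
        rw [show (∑ j ∈ Finset.range N, V i j m * if a₂ ω = j then (1 : ℝ) else 0) =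
          V i (a₂ ω) m by simp [h₂ ω]]
      have hrelu : ∀ i < N, ∀ ω, reluFn (u i) ω =
          if i = a₁ ω then (if l ω = m then V i (a₂ ω) m else 0) else 0 := by
        intro i hi ω
        have h0 := hV i (a₂ ω) m
        have h3 := hVb i hi _ (h₂ ω)
        simp only [reluFn, hu']
        by_cases h4 : i = a₁ ω
        · by_cases h5 : l ω = m
          · simp only [h4.symm, h5, if_true]
            rw [max_eq_left (by linarith)]; ring
          · simp only [h4.symm, h5, if_true, if_false]
            rw [max_eq_right (by linarith)]
        · by_cases h5 : l ω = m
          · simp only [h4, Ne.symm h4, h5, if_true, if_false]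
            rw [max_eq_right (by linarith)]
          · simp only [h4, Ne.symm h4, h5, if_false]
            rw [max_eq_right (by linarith)]
      refine (hA.relu ((List.range N).map u ++ (acc m :: C)) ?_ ?_).mono ?_
      · intro f hf
        rcases List.mem_append.1 hf with hf | hf
        · obtain ⟨i, hi, rfl⟩ := List.mem_map.1 hf
          refine sub_mem (add_mem (add_mem (sum_mem fun j hj => ?_) ?_) ?_) (const_mem_affSpan _)
          · exact V₁.smul_mem _ (e₂ j (Finset.mem_range.1 hj))
          · exact V₁.smul_mem _ (e₁ i (List.mem_range.1 hi))
          · exact V₁.smul_mem _ e₃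
        · exact subset_affSpan (Or.inr hf)
      · simp; omega
      · have hpass : ∀ c ∈ acc m :: C,
            c ∈ affSpan (reluFn '' {f | f ∈ (List.range N).map u ++ (acc m :: C)}) :=
          fun c hc => subset_affSpan ⟨c, List.mem_append_right _ hc, reluFn_eq_self (hC' c hc)⟩
        intro f hf
        rcases List.mem_cons.1 hf with rfl | hf
        · have : acc (m + 1) = acc m + ∑ i ∈ Finset.range N, reluFn (u i) := by
            ext ω
            rw [Pi.add_apply, Finset.sum_apply,
              Finset.sum_congr rfl fun i hi => hrelu i (Finset.mem_range.1 hi) ω,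
              Finset.sum_ite_eq' , if_pos (Finset.mem_range.2 (h₁ ω))]
            simp only [acc]
            rcases lt_trichotomy (l ω) m with h | h | h
            · simp [h, h.ne, show l ω < m + 1 by omega]
            · simp [h]
            · simp [h.ne', show ¬ l ω < m by omega, show ¬ l ω < m + 1 by omega]
          rw [this]
          refine add_mem (hpass _ List.mem_cons_self) (sum_mem fun i hi => subset_affSpan ⟨_, ?_, rfl⟩)
          exact List.mem_append_left _ (List.mem_map.2 ⟨i, List.mem_range.2 (Finset.mem_range.1 hi), rfl⟩)
        · exact hpass f (List.mem_cons_of_mem _ hf)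
  have : (fun ω => V (a₁ ω) (a₂ ω) (l ω)) = acc L := by
    ext ω; simp [acc, hL ω]
  rw [this]
  exact key L

end Lookup

/-- The number with binary digits `θ t, …, θ (t + n - 1)`, most significant first. -/
def bitEncode (θ : ℕ → ℕ) : ℕ → ℕ → ℕ
  | _, 0 => 0
  | t, n + 1 => θ t * 2 ^ n + bitEncode θ (t + 1) n

lemma bitEncode_lt {θ : ℕ → ℕ} (hθ : ∀ t, θ t ≤ 1) (n t : ℕ) : bitEncode θ t n < 2 ^ n := by
  induction n generalizing t with
  | zero => simp [bitEncode]
  | succ n ih =>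
    have h1 := ih (t + 1)
    have h2 := Nat.mul_le_mul_right (2 ^ n) (hθ t)
    rw [bitEncode, pow_succ]
    omega

section Approximation

variable {Ω : Type*} {B S : Set (Ω → ℝ)} {W D : ℕ}

lemma nonnegInd_image_singleton (f : Ω → ℝ) :
    nonnegInd '' {t | t ∈ [f]} = {nonnegInd f} := by
  ext g; simp [eq_comm]

lemma nonnegInd_image_pair (f g : Ω → ℝ) :
    nonnegInd '' {t | t ∈ [f, g]} = {nonnegInd f, nonnegInd g} := by
  ext g; simp [eq_comm]

/-- Bit extraction: the sum of the first `b` encoded bits is computed in `2 * n` layers. -/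
lemma Layered.sum_bits (θ : Ω → ℕ → ℕ) (hθ : ∀ ω t, θ ω t ≤ 1) (b : Ω → ℕ) (C : List (Ω → ℝ))
    (hC0 : ∀ c ∈ C, ∀ ω, 0 ≤ c ω) (hW : 7 + C.length ≤ W) (n : ℕ) (t D : ℕ) (acc : Ω → ℕ)
    (h : Layered B W D {c | c ∈ (fun ω => (bitEncode (θ ω) t n : ℝ)) ::
      (fun ω => (b ω : ℝ)) :: (fun ω => (acc ω : ℝ)) :: C}) :
    Layered B W (D + 2 * n) {c | c ∈ (fun ω => (b ω : ℝ)) ::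
      (fun ω => ((acc ω + ∑ u ∈ Finset.range n,
        if t + u < b ω then θ ω (t + u) else 0 : ℕ) : ℝ)) :: C} := by
  induction n generalizing t D acc with
  | zero =>
    refine h.mono fun c hc => subset_affSpan ?_
    refine List.mem_cons_of_mem _ ?_
    simpa using hc
  | succ n ih =>
    set R : Ω → ℝ := fun ω => (bitEncode (θ ω) t (n + 1) : ℝ) with hR
    set b' : Ω → ℝ := fun ω => (b ω : ℝ) with hb'
    set acc' : Ω → ℝ := fun ω => (acc ω : ℝ) with hacc'
    set R' : Ω → ℝ := fun ω => (bitEncode (θ ω) (t + 1) n : ℝ) with hR'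
    have hpos : ∀ c ∈ b' :: acc' :: C, ∀ ω, 0 ≤ c ω := by
      intro c hc ω
      rcases List.mem_cons.1 hc with rfl | hc
      · exact Nat.cast_nonneg _
      · rcases List.mem_cons.1 hc with rfl | hc
        · exact Nat.cast_nonneg _
        · exact hC0 c hc ω
    have hA := h.threshold [fun ω => (bitEncode (θ ω) t (n + 1) : ℝ) - (2 ^ n : ℕ),
      fun ω => (b ω : ℝ) - (t + 1 : ℕ)] (R :: b' :: acc' :: C)
      (by
        intro f hf
        simp only [List.mem_cons, List.not_mem_nil, or_false] at hf
        rcases hf with rfl | rfl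
        · exact sub_mem (subset_affSpan (List.mem_cons_self)) (const_mem_affSpan _)
        · exact sub_mem (subset_affSpan (List.mem_cons_of_mem _ List.mem_cons_self))
            (const_mem_affSpan _))
      (by
        intro f hf
        simp only [List.mem_cons, List.not_mem_nil, or_false] at hf
        rcases hf with rfl | rfl
        · exact nonneg_or_le_of_int fun ω =>
            ⟨(bitEncode (θ ω) t (n + 1) : ℤ) - (2 ^ n : ℕ), by push_cast; rfl⟩
        · exact nonneg_or_le_of_int fun ω => ⟨(b ω : ℤ) - (t + 1 : ℕ), by push_cast; rfl⟩)
      (fun c hc => subset_affSpan hc)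
      (by
        intro c hc ω
        rcases List.mem_cons.1 hc with rfl | hc
        · exact Nat.cast_nonneg _
        · exact hpos c hc ω)
      (by simp; omega)
    rw [nonnegInd_image_pair] at hA
    rw [nonnegInd_natCast_sub, nonnegInd_natCast_sub] at hA
    have hbit : (fun ω => if 2 ^ n ≤ bitEncode (θ ω) t (n + 1) then (1 : ℝ) else 0) =
        fun ω => (θ ω t : ℝ) := by
      ext ω
      have h1 := bitEncode_lt (hθ ω) n (t + 1)
      rcases Nat.le_one_iff_eq_zero_or_eq_one.1 (hθ ω t) with h0 | h0
      · rw [if_neg (by rw [bitEncode, h0]; omega), h0]; simp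
      · rw [if_pos (by rw [bitEncode, h0]; omega), h0]; simp
    rw [hbit] at hA
    set ind : Ω → ℝ := fun ω => if t + 1 ≤ b ω then 1 else 0 with hind
    set S₁ : Set (Ω → ℝ) := {fun ω => (θ ω t : ℝ), ind} ∪ {c | c ∈ R :: b' :: acc' :: C} with hS₁
    have hθm : (fun ω => (θ ω t : ℝ)) ∈ affSpan S₁ := subset_affSpan (Or.inl (Or.inl rfl))
    have hindm : ind ∈ affSpan S₁ := subset_affSpan (Or.inl (Or.inr rfl))
    have hR'm : R' ∈ affSpan S₁ := by
      have : R' = R - (2 ^ n : ℝ) • fun ω => (θ ω t : ℝ) := by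
        ext ω
        simp [hR', hR, bitEncode]; ring
      rw [this]
      exact sub_mem (subset_affSpan (Or.inr List.mem_cons_self)) ((affSpan S₁).smul_mem _ hθm)
    have hBt := hA.threshold [fun ω => ((θ ω t + (if t + 1 ≤ b ω then 1 else 0) : ℕ) : ℝ) - (2 : ℕ)]
      (R' :: b' :: acc' :: C)
      (by
        intro f hf
        simp only [List.mem_cons, List.not_mem_nil, or_false] at hf
        subst hf
        convert sub_mem (add_mem hθm hindm) (const_mem_affSpan 2) using 1
        ext ω
        simp [hind])
      (by
        intro f hf
        simp only [List.mem_cons, List.not_mem_nil, or_false] at hf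
        subst hf
        exact nonneg_or_le_of_int fun ω =>
          ⟨((θ ω t + (if t + 1 ≤ b ω then 1 else 0) : ℕ) : ℤ) - (2 : ℕ), by push_cast; rfl⟩)
      (by
        intro c hc
        rcases List.mem_cons.1 hc with rfl | hc
        · exact hR'm
        · exact subset_affSpan (Or.inr (List.mem_cons_of_mem _ hc)))
      (by
        intro c hc ω
        rcases List.mem_cons.1 hc with rfl | hc
        · exact Nat.cast_nonneg _
        · exact hpos c hc ω)
      (by simp; omega)
    have hnext := ih (t + 1) (D + 1 + 1) (fun ω => acc ω + if t < b ω then θ ω t else 0)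
      (hBt.mono (by
        intro c hc
        rcases List.mem_cons.1 hc with rfl | hc
        · exact subset_affSpan (Or.inr List.mem_cons_self)
        rcases List.mem_cons.1 hc with rfl | hc
        · exact subset_affSpan (Or.inr (List.mem_cons_of_mem _ List.mem_cons_self))
        rcases List.mem_cons.1 hc with rfl | hc
        · rw [nonnegInd_image_singleton, nonnegInd_natCast_sub]
          have : (fun ω => ((acc ω + if t < b ω then θ ω t else 0 : ℕ) : ℝ)) = acc' + fun ω =>
              if 2 ≤ θ ω t + (if t + 1 ≤ b ω then 1 else 0) then (1 : ℝ) else 0 := by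
            ext ω
            simp only [hacc', Pi.add_apply, Nat.succ_le_iff (m := t)]
            rcases Nat.le_one_iff_eq_zero_or_eq_one.1 (hθ ω t) with h0 | h0 <;>
              by_cases h1 : t < b ω <;> simp [h0, h1]
          rw [this]
          refine add_mem (subset_affSpan (Or.inr ?_)) (subset_affSpan (Or.inl rfl))
          exact List.mem_cons_of_mem _ (List.mem_cons_of_mem _ List.mem_cons_self)
        · exact subset_affSpan (Or.inr (List.mem_cons_of_mem _ (List.mem_cons_of_mem _
            (List.mem_cons_of_mem _ hc))))))
    rw [show D + 2 * (n + 1) = D + 1 + 1 + 2 * n by ring]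
    convert hnext using 6
    funext ω
    rw [Finset.sum_range_succ']
    congr 1
    simp only [add_zero, add_assoc, add_comm 1]
    omega

end Approximation

lemma sum_mul_pow_lt {s n : ℕ} (f : Fin s → ℕ) (hf : ∀ i, f i < n) :
    ∑ i, f i * n ^ (i : ℕ) < n ^ s := by
  have := (finFunctionFinEquiv fun i => (⟨f i, hf i⟩ : Fin n)).2
  rwa [finFunctionFinEquiv_apply] at this

lemma sum_mul_pow_digit {s n : ℕ} (f : Fin s → ℕ) (hf : ∀ i, f i < n) (j : Fin s) :
    (∑ i, f i * n ^ (i : ℕ)) / n ^ (j : ℕ) % n = f j := by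
  have h1 := finFunctionFinEquiv_symm_apply_val
    (finFunctionFinEquiv fun i => (⟨f i, hf i⟩ : Fin n)) j
  rw [Equiv.symm_apply_apply, finFunctionFinEquiv_apply] at h1
  exact h1.symm

/-- The triangle wave on `ℕ` of period `2 * m` and range `{0, …, m - 1}`. -/
def foldMod (m x : ℕ) : ℕ := if x % (2 * m) < m then x % (2 * m) else 2 * m - 1 - x % (2 * m)

lemma foldMod_succ (m x : ℕ) (hm : 0 < m) :
    foldMod m (x + 1) ≤ foldMod m x + 1 ∧ foldMod m x ≤ foldMod m (x + 1) + 1 := by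
  have h1 : x % (2 * m) < 2 * m := Nat.mod_lt _ (by omega)
  have h2 : (x + 1) % (2 * m) = if x % (2 * m) + 1 = 2 * m then 0 else x % (2 * m) + 1 := by
    rw [Nat.add_mod]
    split_ifs with h
    · rcases Nat.lt_or_ge 1 (2 * m) with h3 | h3
      · rw [Nat.mod_eq_of_lt h3, h, Nat.mod_self]
      · omega
    · rw [Nat.mod_eq_of_lt (a := 1) (by omega), Nat.mod_eq_of_lt (by omega)]
  unfold foldMod
  rw [h2]
  split_ifs <;> omega

lemma foldMod_div_succ (m x c : ℕ) (hm : 0 < m) :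
    foldMod m ((x + 1) / c) ≤ foldMod m (x / c) + 1 ∧
      foldMod m (x / c) ≤ foldMod m ((x + 1) / c) + 1 := by
  rw [Nat.succ_div]
  split_ifs
  · exact foldMod_succ m _ hm
  · simp

/-- The coordinates of the `j`-th cell visited in the block with encoded coordinates
`A₁, A₂, A₃`. -/
def blockCell (s n m : ℕ) (A₁ A₂ A₃ j : ℕ) (i : Fin s) : ℕ :=
  A₁ / n ^ (i : ℕ) % n * (n * m * m) + A₂ / n ^ (i : ℕ) % n * (m * m) +
    A₃ / m ^ (i : ℕ) % m * m + foldMod m (j / (2 * m) ^ (i : ℕ))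

lemma exists_quantization (H : ℕ → ℝ) (ε : ℝ) (hε : 0 < ε) (hH : ∀ j, |H (j + 1) - H j| ≤ ε) :
    ∃ (q : ℤ) (θ : ℕ → ℕ), (∀ t, θ t ≤ 1) ∧
      ∀ b : ℕ, |ε * (2 * (q + ∑ u ∈ Finset.range b, (θ u : ℝ)) - b) - H b| ≤ 2 * ε := by
  let Q : ℕ → ℤ := fun j => ⌊(H j / ε + j) / 2⌋
  have hstep : ∀ j, Q j ≤ Q (j + 1) ∧ Q (j + 1) ≤ Q j + 1 := by
    intro j
    have h := abs_le.1 (hH j)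
    have h1 : -1 ≤ H (j + 1) / ε - H j / ε := by
      rw [← sub_div, le_div_iff₀ hε]; linarith
    have h2 : H (j + 1) / ε - H j / ε ≤ 1 := by
      rw [← sub_div, div_le_iff₀ hε]; linarith
    constructor
    · refine Int.floor_le_floor ?_
      push_cast; linarith
    · rw [← Int.floor_add_one]
      refine Int.floor_le_floor ?_
      push_cast; linarith
  have hsum : ∀ b : ℕ, (Q b : ℝ) =
      Q 0 + ∑ u ∈ Finset.range b, (((Q (u + 1) - Q u).toNat : ℕ) : ℝ) := by
    intro b
    induction b with
    | zero => simp
    | succ b ih =>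
      rw [Finset.sum_range_succ, ← add_assoc, ← ih]
      have h1 : (((Q (b + 1) - Q b).toNat : ℕ) : ℤ) = Q (b + 1) - Q b :=
        Int.toNat_of_nonneg (by linarith [(hstep b).1])
      have h2 : (((Q (b + 1) - Q b).toNat : ℕ) : ℝ) = Q (b + 1) - Q b := by exact_mod_cast h1
      rw [h2]; ring
  refine ⟨Q 0, fun u => (Q (u + 1) - Q u).toNat, fun t => ?_, fun b => ?_⟩
  · have := hstep t
    simp only
    omega
  · rw [← hsum b]
    have h1 : (Q b : ℝ) ≤ (H b / ε + b) / 2 := Int.floor_le _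
    have h2 : (H b / ε + b) / 2 < Q b + 1 := Int.lt_floor_add_one _
    have h3 : H b = ε * (H b / ε) := by field_simp
    have h4 : ε * (2 * (Q b : ℝ) - b) - H b = ε * (2 * Q b - b - H b / ε) := by
      rw [mul_sub ε (2 * (Q b : ℝ) - b), ← h3]
    rw [h4, abs_mul, abs_of_pos hε, mul_comm 2 ε]
    refine mul_le_mul_of_nonneg_left ?_ hε.le
    rw [abs_le]
    constructor <;> linarith

section Assembly

variable {Ω : Type*} {s : ℕ}

/-- A network which reads the integer parts of its inputs and reproduces, up to a constant multiple
of the oscillation, a given function of them. -/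
lemma exists_layered_approx (k : Fin s → Ω → ℕ) (r : Fin s → Ω → ℝ)
    (hr : ∀ i ω, 0 ≤ r i ω ∧ r i ω ≤ 3 / 4) (n m T : ℕ) (hn : 0 < n) (hm : 0 < m)
    (hT : m = 1 ∨ (2 * m) ^ s ≤ T) (hk : ∀ i ω, k i ω < n * (n * m * m))
    (F : (Fin s → ℕ) → ℝ) (ε : ℝ) (hε : 0 < ε)
    (hF : ∀ a b : Fin s → ℕ, (∀ i, a i ≤ b i + 1 ∧ b i ≤ a i + 1) → |F a - F b| ≤ ε)
    (W : ℕ) (hW₁ : 7 * (s * n) ≤ W) (hW₂ : 4 * n ^ s + 15 ≤ W) :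
    ∃ φ : Ω → ℝ, Layered (perturbed k r) W (2 + 2 * m + 6 * m ^ s + 2 * T) {φ} ∧
      ∀ ω, |φ ω - F fun i => k i ω| ≤ 2 * ε := by
  have hsn : s ≤ s * n := Nat.le_mul_of_pos_right s hn
  set k₁ : Fin s → Ω → ℕ := fun i ω => k i ω / (n * m * m)
  set k₁' : Fin s → Ω → ℕ := fun i ω => k i ω % (n * m * m)
  set k₂ : Fin s → Ω → ℕ := fun i ω => k₁' i ω / (m * m)
  set k₂' : Fin s → Ω → ℕ := fun i ω => k₁' i ω % (m * m)
  set k₃ : Fin s → Ω → ℕ := fun i ω => k₂' i ω / m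
  set k₃' : Fin s → Ω → ℕ := fun i ω => k₂' i ω % m
  set k₄ : Fin s → Ω → ℕ := fun i ω => k₃' i ω / 1
  have h₁ : ∀ i ω, k₁ i ω < n := fun i ω => Nat.div_lt_of_lt_mul (by rw [mul_comm]; exact hk i ω)
  have h₂ : ∀ i ω, k₂ i ω < n := fun i ω => Nat.div_lt_of_lt_mul (by
    have : k₁' i ω < n * m * m := Nat.mod_lt _ (by positivity)
    calc k₁' i ω < n * m * m := this
      _ = m * m * n := by ring)
  have h₃ : ∀ i ω, k₃ i ω < m := fun i ω => Nat.div_lt_of_lt_mul (Nat.mod_lt _ (by positivity))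
  have h₄ : ∀ i ω, k₄ i ω < m := fun i ω => by
    simp only [k₄, Nat.div_one]; exact Nat.mod_lt _ hm
  have hkdec : ∀ i ω, k i ω = k₁ i ω * (n * m * m) + k₂ i ω * (m * m) + k₃ i ω * m + k₄ i ω := by
    intro i ω
    have e1 := Nat.div_add_mod (k i ω) (n * m * m)
    have e2 := Nat.div_add_mod (k₁' i ω) (m * m)
    have e3 := Nat.div_add_mod (k₂' i ω) m
    simp only [k₄, Nat.div_one, k₃', k₃, k₂, k₁]
    simp only [k₂', k₁'] at *
    linarith
  have hcast : ∀ (f : Fin s → Ω → ℕ), ∀ c ∈ (List.finRange s).map (fun i ω => (f i ω : ℝ)),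
      ∀ ω, 0 ≤ c ω := by
    intro f c hc ω
    obtain ⟨i, -, rfl⟩ := List.mem_map.1 hc
    exact Nat.cast_nonneg _
  have happ : ∀ C₁ C₂ : List (Ω → ℝ), (∀ c ∈ C₁, ∀ ω, 0 ≤ c ω) → (∀ c ∈ C₂, ∀ ω, 0 ≤ c ω) →
      ∀ c ∈ C₁ ++ C₂, ∀ ω, 0 ≤ c ω := by
    intro C₁ C₂ h1 h2 c hc
    rcases List.mem_append.1 hc with hc | hc
    exacts [h1 c hc, h2 c hc]
  have hL₀ : Layered (perturbed k r) W 0 (perturbed k r ∪ {c | c ∈ ([] : List (Ω → ℝ))}) := by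
    rintro _ (hc | hc)
    · exact subset_affSpan hc
    · exact absurd hc (by simp)
  have hL₁ := hL₀.divMod_wide k r hr (n * m * m) n (by positivity) (fun i ω => (h₁ i ω).le) _
    (by simp) (by simp; omega)
  have hC₁ := happ _ _ (hcast k₁) (fun c hc => absurd hc (List.not_mem_nil))
  have hL₂ := hL₁.divMod_wide k₁' r hr (m * m) n (by positivity) (fun i ω => (h₂ i ω).le) _ hC₁
    (by simp; omega)
  have hC₂ := happ _ _ (hcast k₂) hC₁
  have hL₃ := hL₂.divMod_deep k₂' r hr m m hm (fun i ω => (h₃ i ω).le) _ hC₂ (by simp; omega)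
  have hC₃ := happ _ _ (hcast k₃) hC₂
  have hL₄ := hL₃.divMod_deep k₃' r hr 1 m one_pos (fun i ω => (h₄ i ω).le) _ hC₃
    (by simp; omega)
  let comb : (Fin s → Ω → ℕ) → ℕ → Ω → ℕ := fun f M ω => ∑ i, f i ω * M ^ (i : ℕ)
  have hcomb : ∀ (f : Fin s → Ω → ℕ) (M : ℕ) (V : Submodule ℝ (Ω → ℝ)),
      (∀ i, (fun ω => (f i ω : ℝ)) ∈ V) → (fun ω => (comb f M ω : ℝ)) ∈ V := by
    intro f M V hV
    have : (fun ω => (comb f M ω : ℝ)) =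
        ∑ i : Fin s, ((M ^ (i : ℕ) : ℕ) : ℝ) • fun ω => (f i ω : ℝ) := by
      ext ω
      simp [comb, mul_comm]
    rw [this]
    exact sum_mem fun i _ => V.smul_mem _ (hV i)
  set a₁ := comb k₁ n with ha₁
  set a₂ := comb k₂ n with ha₂
  set a₃ := comb k₃ m with ha₃
  set b := comb k₄ (2 * m) with hb
  have hbT : ∀ ω, b ω ≤ T := by
    intro ω
    rcases hT with h | h
    · have : b ω = 0 := by
        simp only [hb, comb]
        refine Finset.sum_eq_zero fun i _ => ?_
        have := h₄ i ω
        rw [show k₄ i ω = 0 by omega, zero_mul]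
      omega
    · exact ((sum_mul_pow_lt (fun i => k₄ i ω) fun i => (h₄ i ω).trans (by omega)).trans_le h).le
  have hcell : ∀ ω, blockCell s n m (a₁ ω) (a₂ ω) (a₃ ω) (b ω) = fun i => k i ω := by
    intro ω
    ext i
    have e1 := sum_mul_pow_digit (fun i => k₁ i ω) (fun i => h₁ i ω) i
    have e2 := sum_mul_pow_digit (fun i => k₂ i ω) (fun i => h₂ i ω) i
    have e3 := sum_mul_pow_digit (fun i => k₃ i ω) (fun i => h₃ i ω) i
    have e4 := sum_mul_pow_digit (fun i => k₄ i ω) (n := 2 * m)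
      (fun i => (h₄ i ω).trans (by omega)) i
    simp only [blockCell, ha₁, ha₂, ha₃, hb, comb, foldMod]
    rw [e1, e2, e3, e4, if_pos (h₄ i ω), ← hkdec]
  -- quantization along each block
  have hquant := fun A₁ A₂ A₃ => exists_quantization (fun j => F (blockCell s n m A₁ A₂ A₃ j)) ε hε
    (fun j => hF _ _ fun i => by
      have := foldMod_div_succ m j ((2 * m) ^ (i : ℕ)) hm
      simp only [blockCell]
      omega)
  choose q θ hθ hq using hquant
  set C₀ : List (Ω → ℝ) := [fun ω => (a₁ ω : ℝ), fun ω => (a₂ ω : ℝ), fun ω => (a₃ ω : ℝ),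
    fun ω => (b ω : ℝ)] with hC₀
  have hL₅ : Layered (perturbed k r) W (0 + 1 + 1 + m + m) {c | c ∈ C₀} := by
    refine hL₄.mono ?_
    intro c hc
    simp only [hC₀, List.mem_cons, List.not_mem_nil, or_false, Set.mem_ofPred_eq] at hc
    rcases hc with rfl | rfl | rfl | rfl
    · refine hcomb _ _ _ fun i => subset_affSpan (Or.inr ?_)
      exact List.mem_append_right _ (List.mem_append_right _ (List.mem_append_right _
        (List.mem_append_left _ (List.mem_map.2 ⟨i, List.mem_finRange i, rfl⟩))))
    · refine hcomb _ _ _ fun i => subset_affSpan (Or.inr ?_)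
      exact List.mem_append_right _ (List.mem_append_right _
        (List.mem_append_left _ (List.mem_map.2 ⟨i, List.mem_finRange i, rfl⟩)))
    · refine hcomb _ _ _ fun i => subset_affSpan (Or.inr ?_)
      exact List.mem_append_right _
        (List.mem_append_left _ (List.mem_map.2 ⟨i, List.mem_finRange i, rfl⟩))
    · refine hcomb _ _ _ fun i => subset_affSpan (Or.inr ?_)
      exact List.mem_append_left _ (List.mem_map.2 ⟨i, List.mem_finRange i, rfl⟩)
  have hcons : ∀ (f : Ω → ℝ) (C : List (Ω → ℝ)), (∀ ω, 0 ≤ f ω) → (∀ c ∈ C, ∀ ω, 0 ≤ c ω) →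
      ∀ c ∈ f :: C, ∀ ω, 0 ≤ c ω := by
    intro f C h1 h2 c hc
    rcases List.mem_cons.1 hc with rfl | hc
    exacts [h1, h2 c hc]
  have hC₀pos : ∀ c ∈ C₀, ∀ ω, 0 ≤ c ω := by
    intro c hc ω
    simp only [hC₀, List.mem_cons, List.not_mem_nil, or_false] at hc
    rcases hc with rfl | rfl | rfl | rfl <;> exact Nat.cast_nonneg _
  have ha₁n : ∀ ω, a₁ ω < n ^ s := fun ω => sum_mul_pow_lt _ fun i => h₁ i ω
  have ha₂n : ∀ ω, a₂ ω < n ^ s := fun ω => sum_mul_pow_lt _ fun i => h₂ i ω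
  have ha₃m : ∀ ω, a₃ ω < m ^ s := fun ω => sum_mul_pow_lt _ fun i => h₃ i ω
  have hp : ∀ i j l, 0 ≤ max (q i j l : ℝ) 0 := fun i j l => le_max_right _ _
  have hp' : ∀ i j l, 0 ≤ max (-q i j l : ℝ) 0 := fun i j l => le_max_right _ _
  have hL₆ := hL₅.lookup (fun i j l => max (q i j l : ℝ) 0) hp (n ^ s) a₁ a₂ a₃ ha₁n ha₂n C₀ hC₀pos
    (by simp [hC₀]) (by simp [hC₀]) (by simp [hC₀]) (by simp [hC₀]; omega) (m ^ s) ha₃m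
  have hC₆ := hcons _ _ (fun ω => hp (a₁ ω) (a₂ ω) (a₃ ω)) hC₀pos
  have hL₇ := hL₆.lookup (fun i j l => max (-q i j l : ℝ) 0) hp' (n ^ s) a₁ a₂ a₃ ha₁n ha₂n _ hC₆
    (by simp [hC₀]) (by simp [hC₀]) (by simp [hC₀]) (by simp [hC₀]; omega) (m ^ s) ha₃m
  have hC₇ := hcons _ _ (fun ω => hp' (a₁ ω) (a₂ ω) (a₃ ω)) hC₆
  have hL₈ := hL₇.lookup (fun i j l => (bitEncode (θ i j l) 0 T : ℝ))
    (fun _ _ _ => Nat.cast_nonneg _) (n ^ s) a₁ a₂ a₃ ha₁n ha₂n _ hC₇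
    (by simp [hC₀]) (by simp [hC₀]) (by simp [hC₀]) (by simp [hC₀]; omega) (m ^ s) ha₃m
  set qp : Ω → ℝ := fun ω => max (q (a₁ ω) (a₂ ω) (a₃ ω) : ℝ) 0 with hqp
  set qm : Ω → ℝ := fun ω => max (-q (a₁ ω) (a₂ ω) (a₃ ω) : ℝ) 0 with hqm
  set θ' : Ω → ℕ → ℕ := fun ω => θ (a₁ ω) (a₂ ω) (a₃ ω) with hθ'
  have hL₉ := Layered.sum_bits θ' (fun ω => hθ _ _ _) b [qp, qm]
    (by
      intro c hc ω
      simp only [List.mem_cons, List.not_mem_nil, or_false] at hc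
      rcases hc with rfl | rfl
      exacts [hp _ _ _, hp' _ _ _])
    (by simp; omega) T 0 _ (fun _ => 0) (hL₈.mono (by
      intro c hc
      simp only [List.mem_cons, List.not_mem_nil, or_false, Set.mem_ofPred_eq] at hc
      rcases hc with rfl | rfl | rfl | rfl | rfl
      · exact subset_affSpan (List.mem_cons_self)
      · exact subset_affSpan (by simp [hC₀])
      · simpa using const_mem_affSpan 0
      · exact subset_affSpan (by simp)
      · exact subset_affSpan (by simp)))
  set tot : Ω → ℝ := fun ω => ((0 + ∑ u ∈ Finset.range T,
    if 0 + u < b ω then θ' ω (0 + u) else 0 : ℕ) : ℝ) with htot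
  have htot_eq : ∀ ω, tot ω = ∑ u ∈ Finset.range (b ω), (θ' ω u : ℝ) := by
    intro ω
    simp only [htot, zero_add]
    rw [← Finset.sum_filter, show (Finset.range T).filter (fun u => u < b ω) =
      Finset.range (b ω) by
        ext u
        have := hbT ω
        simp only [Finset.mem_filter, Finset.mem_range]; omega]
    push_cast; rfl
  refine ⟨ε • ((2 : ℝ) • (qp - qm + tot) - fun ω => (b ω : ℝ)), ?_, fun ω => ?_⟩
  · rw [show 2 + 2 * m + 6 * m ^ s + 2 * T =
      0 + 1 + 1 + m + m + 2 * m ^ s + 2 * m ^ s + 2 * m ^ s + 2 * T by ring]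
    refine hL₉.mono (Set.singleton_subset_iff.2 ?_)
    refine Submodule.smul_mem _ _ (sub_mem (Submodule.smul_mem _ _ (add_mem (sub_mem ?_ ?_) ?_)) ?_)
    all_goals exact subset_affSpan (by simp)
  · have := hq (a₁ ω) (a₂ ω) (a₃ ω) (b ω)
    rw [hcell] at this
    convert this using 3
    have hpm : qp ω - qm ω = q (a₁ ω) (a₂ ω) (a₃ ω) := by
      simp only [hqp, hqm]
      rcases le_total 0 (q (a₁ ω) (a₂ ω) (a₃ ω) : ℝ) with h | h
      · rw [max_eq_left h, max_eq_right (by linarith)]; ring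
      · rw [max_eq_right h, max_eq_left (by linarith)]; ring
    simp only [Pi.smul_apply, Pi.sub_apply, Pi.add_apply, smul_eq_mul, hpm, htot_eq]
    rfl

end Assembly

/-- The middle value of three real numbers. -/
def med3 (a b c : ℝ) : ℝ :=
  a + b - c - max (b + max (a - b) 0 - c) 0 + max (c - a + max (a - b) 0) 0

lemma med3_near {a b c f ε : ℝ}
    (h : (|a - f| ≤ ε ∧ |b - f| ≤ ε) ∨ (|a - f| ≤ ε ∧ |c - f| ≤ ε) ∨
      (|b - f| ≤ ε ∧ |c - f| ≤ ε)) : |med3 a b c - f| ≤ ε := by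
  simp only [abs_le] at *
  unfold med3
  rcases le_total (a - b) 0 with h1 | h1
  all_goals
    first
    | rw [max_eq_right h1]
    | rw [max_eq_left h1]
    rcases max_cases (b + 0 - c) 0 with h2 | h2 <;>
    rcases max_cases (c - a + 0) 0 with h3 | h3 <;>
    rcases max_cases (b + (a - b) - c) 0 with h4 | h4 <;>
    rcases max_cases (c - a + (a - b)) 0 with h5 | h5 <;>
    rcases h with h | h | h <;> constructor <;> linarith

/-- The iterated middle value of a family indexed by `Fin n → Fin 3`. -/
def medRec : (n : ℕ) → ((Fin n → Fin 3) → ℝ) → ℝ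
  | 0, c => c Fin.elim0
  | n + 1, c => medRec n fun v =>
      med3 (c (Fin.cons 0 v)) (c (Fin.cons 1 v)) (c (Fin.cons 2 v))

lemma medRec_near {f ε : ℝ} (n : ℕ) (c : (Fin n → Fin 3) → ℝ) (good : Fin n → Fin 3 → Prop)
    (hgood : ∀ i, (good i 0 ∧ good i 1) ∨ (good i 0 ∧ good i 2) ∨ (good i 1 ∧ good i 2))
    (hc : ∀ v, (∀ i, good i (v i)) → |c v - f| ≤ ε) : |medRec n c - f| ≤ ε := by
  induction n with
  | zero => exact hc _ fun i => i.elim0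
  | succ n ih =>
    refine ih _ (fun i => good i.succ) (fun i => hgood i.succ) fun v hv => ?_
    have key : ∀ j, good 0 j → |c (Fin.cons j v) - f| ≤ ε := fun j hj =>
      hc _ fun i => by
        refine Fin.cases ?_ (fun i => ?_) i
        · simpa using hj
        · simpa using hv i
    refine med3_near ?_
    rcases hgood 0 with ⟨h1, h2⟩ | ⟨h1, h2⟩ | ⟨h1, h2⟩
    · exact Or.inl ⟨key _ h1, key _ h2⟩
    · exact Or.inr (Or.inl ⟨key _ h1, key _ h2⟩)
    · exact Or.inr (Or.inr ⟨key _ h1, key _ h2⟩)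

section Median

variable {Ω : Type*} {B : Set (Ω → ℝ)} {W : ℕ}

lemma mem_affSpan_of_pair {U : List (Ω → ℝ)} {f : Ω → ℝ} (h1 : f ∈ U) (h2 : -f ∈ U) :
    f ∈ affSpan (reluFn '' {f | f ∈ U}) := by
  have := sub_mem (subset_affSpan (S := reluFn '' {f | f ∈ U}) ⟨f, h1, rfl⟩)
    (subset_affSpan (S := reluFn '' {f | f ∈ U}) ⟨-f, h2, rfl⟩)
  rwa [reluFn_sub_reluFn_neg] at this

lemma length_flatMap_univ {α κ : Type*} [Fintype κ] (F : κ → List α) (c : ℕ)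
    (hF : ∀ v, (F v).length = c) :
    ((Finset.univ : Finset κ).toList.flatMap F).length = Fintype.card κ * c := by
  rw [List.length_flatMap]
  simp [hF]

lemma Layered.medRec (n D : ℕ) (hW : 7 * 3 ^ n ≤ W) (Φ : (Fin n → Fin 3) → Ω → ℝ)
    (h : Layered B W D (Set.range Φ)) :
    Layered B W (D + 2 * n) {fun ω => medRec n fun v => Φ v ω} := by
  induction n generalizing D with
  | zero =>
    refine h.mono (Set.singleton_subset_iff.2 (subset_affSpan ⟨Fin.elim0, rfl⟩))
  | succ n ih =>
    set a : (Fin n → Fin 3) → Ω → ℝ := fun v => Φ (Fin.cons 0 v) with ha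
    set b : (Fin n → Fin 3) → Ω → ℝ := fun v => Φ (Fin.cons 1 v) with hb
    set c : (Fin n → Fin 3) → Ω → ℝ := fun v => Φ (Fin.cons 2 v) with hc
    have hΦ : ∀ v, Φ v ∈ affSpan (Set.range Φ) := fun v => subset_affSpan ⟨v, rfl⟩
    have h3 : 3 ^ n ≤ 3 ^ (n + 1) := Nat.pow_le_pow_right (by norm_num) (Nat.le_succ n)
    set U := (Finset.univ : Finset (Fin n → Fin 3)).toList.flatMap fun v =>
      [a v - b v, a v, -a v, b v, -b v, c v, -c v] with hU
    have hUm : ∀ v, ∀ f ∈ [a v - b v, a v, -a v, b v, -b v, c v, -c v], f ∈ U := fun v f hf =>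
      List.mem_flatMap.2 ⟨v, by simp, hf⟩
    have h₁ := h.relu U (by
      intro f hf
      obtain ⟨v, -, hf⟩ := List.mem_flatMap.1 hf
      simp only [List.mem_cons, List.not_mem_nil, or_false] at hf
      rcases hf with rfl | rfl | rfl | rfl | rfl | rfl | rfl
      · exact sub_mem (hΦ _) (hΦ _)
      · exact hΦ _
      · exact neg_mem (hΦ _)
      · exact hΦ _
      · exact neg_mem (hΦ _)
      · exact hΦ _
      · exact neg_mem (hΦ _)) (by
      rw [length_flatMap_univ _ 7 (fun v => rfl)]
      simp only [Fintype.card_fun, Fintype.card_fin]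
      omega)
    set V₁ := affSpan (reluFn '' {f | f ∈ U})
    have hd : ∀ v, reluFn (a v - b v) ∈ V₁ := fun v =>
      subset_affSpan ⟨_, hUm v _ (by simp), rfl⟩
    have hav : ∀ v, a v ∈ V₁ := fun v =>
      mem_affSpan_of_pair (hUm v _ (by simp)) (hUm v _ (by simp))
    have hbv : ∀ v, b v ∈ V₁ := fun v =>
      mem_affSpan_of_pair (hUm v _ (by simp)) (hUm v _ (by simp))
    have hcv : ∀ v, c v ∈ V₁ := fun v =>
      mem_affSpan_of_pair (hUm v _ (by simp)) (hUm v _ (by simp))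
    set U' := (Finset.univ : Finset (Fin n → Fin 3)).toList.flatMap fun v =>
      [b v + reluFn (a v - b v) - c v, c v - a v + reluFn (a v - b v), a v + b v - c v,
        -(a v + b v - c v)] with hU'
    have hUm' : ∀ v, ∀ f ∈ [b v + reluFn (a v - b v) - c v, c v - a v + reluFn (a v - b v),
        a v + b v - c v, -(a v + b v - c v)], f ∈ U' := fun v f hf =>
      List.mem_flatMap.2 ⟨v, by simp, hf⟩
    have h₂ := h₁.relu U' (by
      intro f hf
      obtain ⟨v, -, hf⟩ := List.mem_flatMap.1 hf
      simp only [List.mem_cons, List.not_mem_nil, or_false] at hf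
      rcases hf with rfl | rfl | rfl | rfl
      · exact sub_mem (add_mem (hbv v) (hd v)) (hcv v)
      · exact add_mem (sub_mem (hcv v) (hav v)) (hd v)
      · exact sub_mem (add_mem (hav v) (hbv v)) (hcv v)
      · exact neg_mem (sub_mem (add_mem (hav v) (hbv v)) (hcv v))) (by
      rw [length_flatMap_univ _ 4 (fun v => rfl)]
      simp only [Fintype.card_fun, Fintype.card_fin]
      omega)
    set V₂ := affSpan (reluFn '' {f | f ∈ U'})
    have := ih (D + 1 + 1) (by omega) (fun v ω => med3 (a v ω) (b v ω) (c v ω)) (h₂.mono (by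
      rintro _ ⟨v, rfl⟩
      change (fun ω => med3 (a v ω) (b v ω) (c v ω)) ∈ V₂
      have : (fun ω => med3 (a v ω) (b v ω) (c v ω)) = (a v + b v - c v) -
          reluFn (b v + reluFn (a v - b v) - c v) + reluFn (c v - a v + reluFn (a v - b v)) := rfl
      rw [this]
      refine add_mem (sub_mem ?_ ?_) ?_
      · exact mem_affSpan_of_pair (hUm' v _ (by simp)) (hUm' v _ (by simp))
      · exact subset_affSpan ⟨_, hUm' v _ (by simp), rfl⟩
      · exact subset_affSpan ⟨_, hUm' v _ (by simp), rfl⟩))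
    rw [show D + 2 * (n + 1) = D + 1 + 1 + 2 * n by ring]
    exact this

end Median

lemma exists_coeff_of_mem_affSpan {Ω : Type*} {n : ℕ} {v : ℕ → Ω → ℝ} {S : Set (Ω → ℝ)}
    (hS : ∀ g ∈ S, ∃ j < n, g = v j) {f : Ω → ℝ} (hf : f ∈ affSpan S) :
    ∃ (a : ℕ → ℝ) (c : ℝ), ∀ ω, f ω = ∑ j ∈ Finset.range n, a j * v j ω + c := by
  induction hf using Submodule.span_induction with
  | mem g hg =>
    rcases hg with rfl | hg
    · exact ⟨0, 1, fun ω => by simp⟩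
    · obtain ⟨j, hj, rfl⟩ := hS g hg
      exact ⟨Pi.single j 1, 0, fun ω => by simp [Pi.single_apply, hj]⟩
  | zero => exact ⟨0, 0, fun ω => by simp⟩
  | add f g _ _ hf hg =>
    obtain ⟨a, c, h1⟩ := hf
    obtain ⟨a', c', h2⟩ := hg
    refine ⟨a + a', c + c', fun ω => ?_⟩
    simp only [Pi.add_apply, h1, h2, add_mul, Finset.sum_add_distrib]
    ring
  | smul t f _ hf =>
    obtain ⟨a, c, h1⟩ := hf
    refine ⟨t • a, t * c, fun ω => ?_⟩
    simp only [Pi.smul_apply, smul_eq_mul, h1, mul_add, Finset.mul_sum, mul_assoc]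

/-- The forward pass with weights and biases indexed by natural numbers. -/
def rawFwd {p : ℕ} (dims : ℕ → ℕ) (a : ℕ → ℕ → ℕ → ℝ) (b : ℕ → ℕ → ℝ) :
    ℕ → (Fin p → ℝ) → ℕ → ℝ
  | 0 => fun x i => if h : i < p then x ⟨i, h⟩ else 0
  | l + 1 => fun x i =>
      max (∑ j ∈ Finset.range (dims l), a l i j * rawFwd dims a b l x j + b l i) 0

lemma rawFwd_congr {p : ℕ} {dims dims' : ℕ → ℕ} {a a' : ℕ → ℕ → ℕ → ℝ} {b b' : ℕ → ℕ → ℝ}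
    (L : ℕ) (h : ∀ l < L, dims l = dims' l ∧ a l = a' l ∧ b l = b' l) :
    rawFwd (p := p) dims a b L = rawFwd dims' a' b' L := by
  induction L with
  | zero => rfl
  | succ L ih =>
    obtain ⟨h1, h2, h3⟩ := h L (Nat.lt_succ_self L)
    simp only [rawFwd, h1, h2, h3, ih fun l hl => h l (Nat.lt_succ_of_lt hl)]

/-- The coordinate functions. -/
def coordFns (p : ℕ) : Set ((Fin p → ℝ) → ℝ) := Set.range fun j x => x j

lemma Layered.exists_rawFwd {p W D : ℕ} (U : List ((Fin p → ℝ) → ℝ))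
    (h : Layered (coordFns p) W D {f | f ∈ U}) :
    ∃ (dims : ℕ → ℕ) (a : ℕ → ℕ → ℕ → ℝ) (b : ℕ → ℕ → ℝ), dims 0 = p ∧
      dims (D + 1) = U.length ∧ (∀ l, 1 ≤ l → l ≤ D → dims l ≤ W) ∧
      ∀ i < U.length, ∀ x, U.getD i 0 x =
        ∑ j ∈ Finset.range (dims D), a D i j * rawFwd dims a b D x j + b D i := by
  have hget : ∀ {i : ℕ} {U : List ((Fin p → ℝ) → ℝ)}, i < U.length → U.getD i 0 ∈ U := by
    intro i U hi
    rw [List.getD_eq_getElem _ _ hi]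
    exact List.getElem_mem hi
  induction D generalizing U with
  | zero =>
    have : ∀ i, ∃ (a : ℕ → ℝ) (c : ℝ), i < U.length → ∀ x, U.getD i 0 x =
        ∑ j ∈ Finset.range p, a j * (if h : j < p then x ⟨j, h⟩ else 0) + c := by
      intro i
      by_cases hi : i < U.length
      · obtain ⟨a, c, hac⟩ := exists_coeff_of_mem_affSpan (n := p)
          (v := fun j (x : Fin p → ℝ) => if h : j < p then x ⟨j, h⟩ else 0) (S := coordFns p)
          (by
            rintro _ ⟨j, rfl⟩
            exact ⟨j, j.2, by ext x; simp⟩) (h (hget hi))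
        exact ⟨a, c, fun _ => hac⟩
      · exact ⟨0, 0, fun h => absurd h hi⟩
    choose a c hac using this
    exact ⟨fun l => if l = 0 then p else U.length, fun _ => a, fun _ => c, rfl, rfl,
      fun l h1 h2 => by omega, hac⟩
  | succ D ih =>
    obtain ⟨U', hW, hU', hUU'⟩ := h
    obtain ⟨dims, a, b, h0, h1, h2, h3⟩ := ih U' hU'
    have : ∀ i, ∃ (α : ℕ → ℝ) (c : ℝ), i < U.length → ∀ x, U.getD i 0 x =
        ∑ j ∈ Finset.range U'.length, α j * reluFn (U'.getD j 0) x + c := by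
      intro i
      by_cases hi : i < U.length
      · obtain ⟨α, c, hac⟩ := exists_coeff_of_mem_affSpan (n := U'.length)
          (v := fun j => reluFn (U'.getD j 0)) (S := reluFn '' {f | f ∈ U'})
          (by
            rintro _ ⟨f, hf, rfl⟩
            obtain ⟨j, hj, rfl⟩ := List.mem_iff_getElem.1 hf
            exact ⟨j, hj, by rw [List.getD_eq_getElem _ _ hj]⟩) (hUU' (hget hi))
        exact ⟨α, c, fun _ => hac⟩
      · exact ⟨0, 0, fun h => absurd h hi⟩
    choose α c hac using this
    refine ⟨Function.update dims (D + 2) U.length, Function.update a (D + 1) α,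
      Function.update b (D + 1) c, ?_, ?_, ?_, ?_⟩
    · rw [Function.update_of_ne (by omega), h0]
    · rw [Function.update_self]
    · intro l hl hl'
      rw [Function.update_of_ne (by omega)]
      rcases Nat.lt_or_ge D l with h | h
      · rw [show l = D + 1 by omega, h1]; exact hW
      · exact h2 l hl h
    · intro i hi x
      rw [hac i hi x, Function.update_of_ne (by omega), h1, Function.update_self,
        Function.update_self]
      congr 1
      refine Finset.sum_congr rfl fun j hj => ?_
      rw [← rawFwd_congr (dims := dims) (a := a) (b := b) (D + 1) (fun l hl => by
        rw [Function.update_of_ne (by omega), Function.update_of_ne (by omega),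
          Function.update_of_ne (by omega)]
        exact ⟨rfl, rfl, rfl⟩)]
      rw [reluFn, h3 j (Finset.mem_range.1 hj) x]
      rfl

lemma Layered.isReluNet {p W D : ℕ} {g : (Fin p → ℝ) → ℝ}
    (h : Layered (coordFns p) W D {g}) : IsReluNet W D g := by
  obtain ⟨dims, a, b, h0, h1, h2, h3⟩ := Layered.exists_rawFwd [g] (by simpa using h)
  subst h0
  have hfwd : ∀ l x i, fwd dims (fun l => Matrix.of fun i j => a l i j) (fun l i => b l i) l x i =
      rawFwd dims a b l x i := by
    intro l x
    induction l with
    | zero => intro i; simp [fwd, rawFwd]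
    | succ l ih =>
      intro i
      simp only [fwd, rawFwd, Pi.add_apply, Matrix.mulVec, dotProduct, Matrix.of_apply, ih,
        Finset.sum_range]
  refine ⟨dims, rfl, h1, h2, fun l => Matrix.of fun i j => a l i j, fun l i => b l i, fun x => ?_⟩
  have := h3 0 (by simp) x
  simp only [List.getD_cons_zero] at this
  rw [this]
  simp only [Fin.cast_refl, id, Pi.add_apply, Matrix.mulVec, dotProduct, Matrix.of_apply, hfwd,
    Finset.sum_range]
  rfl

section Cube

variable {s : ℕ}

lemma Layered.comp_affine {p W D : ℕ} {φ : (Fin s → ℝ) → ℝ} (h : Layered (coordFns s) W D {φ})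
    (y : (Fin p → ℝ) → Fin s → ℝ) (hy : ∀ i, (fun x => y x i) ∈ affSpan (coordFns p)) :
    Layered (coordFns p) W D {φ ∘ y} := by
  have := (h.comp y).mono_input (B' := coordFns p) (by
    rintro _ ⟨_, ⟨i, rfl⟩, rfl⟩
    exact hy i)
  simpa using this

lemma exists_layered_floor (n m T : ℕ) (hn : 0 < n) (hm : 0 < m)
    (hT : m = 1 ∨ (2 * m) ^ s ≤ T) (F : (Fin s → ℕ) → ℝ) (ε : ℝ) (hε : 0 < ε)
    (hF : ∀ a b : Fin s → ℕ, (∀ i, a i ≤ b i + 1 ∧ b i ≤ a i + 1) → |F a - F b| ≤ ε)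
    (W : ℕ) (hW₁ : 7 * (s * n) ≤ W) (hW₂ : 4 * n ^ s + 15 ≤ W) :
    ∃ φ : (Fin s → ℝ) → ℝ, Layered (coordFns s) W (2 + 2 * m + 6 * m ^ s + 2 * T) {φ} ∧
      ∀ y : Fin s → ℝ, (∀ i, 0 ≤ y i ∧ y i < ((n * (n * m * m) : ℕ) : ℝ) ∧
        Int.fract (y i) ≤ 3 / 4) → |φ y - F fun i => ⌊y i⌋₊| ≤ 2 * ε := by
  set K := n * (n * m * m)
  set Ω := {y : Fin s → ℝ // ∀ i, 0 ≤ y i ∧ y i < (K : ℝ) ∧ Int.fract (y i) ≤ 3 / 4}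
  obtain ⟨φ, h1, h2⟩ := exists_layered_approx (Ω := Ω) (fun i y => ⌊y.1 i⌋₊)
    (fun i y => Int.fract (y.1 i)) (fun i y => ⟨Int.fract_nonneg _, (y.2 i).2.2⟩) n m T hn hm hT
    (fun i y => (Nat.floor_lt (y.2 i).1).2 (y.2 i).2.1) F ε hε hF W hW₁ hW₂
  obtain ⟨S, h3, h4⟩ := Layered.exists_extension (Subtype.val : Ω → Fin s → ℝ)
    (h1.mono_input (B' := (fun f => f ∘ Subtype.val) '' coordFns s) (by
      rintro _ ⟨i, rfl⟩
      refine subset_affSpan ⟨_, ⟨i, rfl⟩, ?_⟩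
      ext y
      simp only [Function.comp_apply]
      rw [natCast_floor_eq_intCast_floor (y.2 i).1, Int.floor_add_fract]))
  obtain ⟨f, hf, rfl⟩ := h4 rfl
  exact ⟨f, h3.mono (Set.singleton_subset_iff.2 (subset_affSpan hf)), fun y hy => h2 ⟨y, hy⟩⟩

lemma fract_shift_le (t : ℝ) :
    (Int.fract (t - 1 / 4) ≤ 3 / 4 ∧ Int.fract t ≤ 3 / 4) ∨
      (Int.fract (t - 1 / 4) ≤ 3 / 4 ∧ Int.fract (t + 1 / 4) ≤ 3 / 4) ∨
      (Int.fract t ≤ 3 / 4 ∧ Int.fract (t + 1 / 4) ≤ 3 / 4) := by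
  have h0 := Int.fract_nonneg t
  have h1 := Int.fract_lt_one t
  have h2 := Int.floor_add_fract t
  have key : ∀ (u r : ℝ) (z : ℤ), 0 ≤ r → r < 1 → u = z + r → Int.fract u = r :=
    fun u r z hr hr' hu => Int.fract_eq_iff.2 ⟨hr, hr', z, by linarith⟩
  rcases lt_or_ge (3 / 4) (Int.fract t) with h | h
  · right; left
    rw [key (t - 1 / 4) (Int.fract t - 1 / 4) ⌊t⌋ (by linarith) (by linarith) (by linarith),
      key (t + 1 / 4) (Int.fract t - 3 / 4) (⌊t⌋ + 1) (by linarith) (by linarith)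
        (by push_cast; linarith)]
    constructor <;> linarith
  · rcases lt_or_ge (Int.fract t) (1 / 4) with h' | h'
    · right; right
      rw [key (t + 1 / 4) (Int.fract t + 1 / 4) ⌊t⌋ (by linarith) (by linarith) (by linarith)]
      constructor <;> linarith
    · left
      rw [key (t - 1 / 4) (Int.fract t - 1 / 4) ⌊t⌋ (by linarith) (by linarith) (by linarith)]
      constructor <;> linarith

lemma exists_layered_cube (n m T : ℕ) (hn : 0 < n) (hm : 0 < m)
    (hT : m = 1 ∨ (2 * m) ^ s ≤ T) (F : (Fin s → ℕ) → ℝ) (ε : ℝ) (hε : 0 < ε)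
    (hF : ∀ a b : Fin s → ℕ, (∀ i, a i ≤ b i + 1 ∧ b i ≤ a i + 1) → |F a - F b| ≤ ε)
    (W : ℕ) (hW₁ : 7 * (s * n) ≤ W) (hW₂ : 4 * n ^ s + 15 ≤ W) :
    ∃ ψ : (Fin s → ℝ) → ℝ,
      Layered (coordFns s) (3 ^ s * W) (2 + 2 * m + 6 * m ^ s + 2 * T + 2 * s) {ψ} ∧
      ∀ (y : Fin s → ℝ) (f : ℝ),
        (∀ i, 1 / 4 ≤ y i ∧ y i ≤ ((n * (n * m * m) : ℕ) : ℝ) - 1 / 2) →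
        (∀ a : Fin s → ℕ, (∀ i, |(a i : ℝ) - y i| ≤ 1) → |F a - f| ≤ ε) →
        |ψ y - f| ≤ 3 * ε := by
  obtain ⟨φ, h1, h2⟩ := exists_layered_floor n m T hn hm hT F ε hε hF W hW₁ hW₂
  set K := n * (n * m * m)
  set σ : Fin 3 → ℝ := ![-(1 / 4), 0, 1 / 4] with hσ
  have hσ' : ∀ j, |σ j| ≤ 1 / 4 := by
    intro j
    fin_cases j <;> simp [hσ, abs_of_pos]
  set shift : (Fin s → Fin 3) → (Fin s → ℝ) → Fin s → ℝ := fun v y i => y i + σ (v i)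
  have h3 := Layered.parallel (Finset.univ : Finset (Fin s → Fin 3)).toList
    (fun v => {φ ∘ shift v}) (fun v _ => h1.comp_affine (shift v) fun i =>
      add_mem (subset_affSpan ⟨i, rfl⟩) (const_mem_affSpan (σ (v i))))
  have hlen : (Finset.univ : Finset (Fin s → Fin 3)).toList.length = 3 ^ s := by simp
  rw [hlen] at h3
  have h4 := (h3.mono (S' := Set.range fun v => φ ∘ shift v) (by
    rintro _ ⟨v, rfl⟩
    exact subset_affSpan ⟨v, by simp, rfl⟩)).medRec s _ (by
      rw [mul_comm]; exact Nat.mul_le_mul_left _ (by omega)) _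
  refine ⟨_, h4, fun y f hy hf => medRec_near s _ (fun i j => Int.fract (y i + σ j) ≤ 3 / 4)
    (fun i => by simpa [hσ, sub_eq_add_neg] using fract_shift_le (y i)) fun v hv => ?_⟩
  have hb : ∀ i, 0 ≤ shift v y i ∧ shift v y i < (K : ℝ) := by
    intro i
    have := abs_le.1 (hσ' (v i))
    have := hy i
    constructor <;> simp only [shift] <;> linarith
  have h5 := h2 (shift v y) fun i => ⟨(hb i).1, (hb i).2, hv i⟩
  have h6 := hf (fun i => ⌊shift v y i⌋₊) fun i => by
    have e : (⌊shift v y i⌋₊ : ℝ) = y i + σ (v i) - Int.fract (y i + σ (v i)) := by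
      rw [natCast_floor_eq_intCast_floor (hb i).1, Int.self_sub_fract]
    have := abs_le.1 (hσ' (v i))
    have := hv i
    have := Int.fract_nonneg (y i + σ (v i))
    rw [e, abs_le]
    constructor <;> linarith
  calc |(φ ∘ shift v) y - f|
      ≤ |φ (shift v y) - F fun i => ⌊shift v y i⌋₊| + |F (fun i => ⌊shift v y i⌋₊) - f| :=
        abs_sub_le _ _ _
    _ ≤ 3 * ε := by linarith

end Cube

lemma euclNorm_le {n : ℕ} {v : Fin n → ℝ} {c : ℝ} (hc : 0 ≤ c) (h : ∀ i, |v i| ≤ c) :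
    euclNorm v ≤ n * c := by
  refine Real.sqrt_le_iff.2 ⟨by positivity, ?_⟩
  calc ∑ i, v i ^ 2 ≤ ∑ _i : Fin n, c ^ 2 :=
        Finset.sum_le_sum fun i _ => by rw [← sq_abs]; gcongr; exact h i
    _ = n * c ^ 2 := by simp
    _ ≤ (n * c) ^ 2 := by
        rw [mul_pow]
        gcongr
        exact_mod_cast Nat.le_self_pow two_ne_zero n

lemma rpow_one_div_pow (s : ℕ) (hs : s ≠ 0) (d : ℕ) : ((d : ℝ) ^ ((1 : ℝ) / s)) ^ s = d := by
  rw [one_div, Real.rpow_inv_natCast_pow (Nat.cast_nonneg d) hs]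

lemma one_le_rpow_one_div (s : ℕ) {d : ℕ} (hd : 0 < d) : 1 ≤ (d : ℝ) ^ ((1 : ℝ) / s) :=
  Real.one_le_rpow (by exact_mod_cast hd) (by positivity)

lemma floor_rpow_one_div (s : ℕ) (hs : s ≠ 0) {w : ℕ} (hw : 0 < w) :
    0 < ⌊(w : ℝ) ^ ((1 : ℝ) / s)⌋₊ ∧ ⌊(w : ℝ) ^ ((1 : ℝ) / s)⌋₊ ^ s ≤ w ∧
      (w : ℝ) ^ ((1 : ℝ) / s) / 2 ≤ ⌊(w : ℝ) ^ ((1 : ℝ) / s)⌋₊ := by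
  have h1 := one_le_rpow_one_div s hw
  have h2 := rpow_one_div_pow s hs w
  set t := (w : ℝ) ^ ((1 : ℝ) / s)
  have h3 : 0 < ⌊t⌋₊ := Nat.floor_pos.2 h1
  have h4 : (1 : ℝ) ≤ ⌊t⌋₊ := by exact_mod_cast h3
  have h5 := Nat.lt_floor_add_one t
  refine ⟨h3, ?_, by linarith⟩
  have : (⌊t⌋₊ : ℝ) ^ s ≤ t ^ s := by gcongr; exact Nat.floor_le (by linarith)
  rw [h2] at this
  exact_mod_cast this

lemma exists_side_length (s : ℕ) (hs : s ≠ 0) {d : ℕ} (hd : 0 < d) :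
    ∃ m : ℕ, 0 < m ∧ m ^ s ≤ d ∧ m ≤ d ∧ (m = 1 ∨ (2 * m) ^ s ≤ d) ∧
      (d : ℝ) ^ ((1 : ℝ) / s) / 4 ≤ m := by
  have h1 := one_le_rpow_one_div s hd
  have h2 := rpow_one_div_pow s hs d
  set t := (d : ℝ) ^ ((1 : ℝ) / s)
  rcases Nat.eq_zero_or_pos ⌊t / 2⌋₊ with h | h
  · rw [Nat.floor_eq_zero] at h
    exact ⟨1, one_pos, by rw [one_pow]; exact hd, hd, Or.inl rfl, by push_cast; linarith⟩
  · have h3 : (2 * ⌊t / 2⌋₊) ^ s ≤ d := by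
      have : (2 * (⌊t / 2⌋₊ : ℝ)) ^ s ≤ t ^ s := by
        gcongr
        linarith [Nat.floor_le (show 0 ≤ t / 2 by linarith)]
      rw [h2] at this
      exact_mod_cast this
    have h4 : ⌊t / 2⌋₊ ^ s ≤ d := (Nat.pow_le_pow_left (by omega) s).trans h3
    have h5 : (1 : ℝ) ≤ ⌊t / 2⌋₊ := by exact_mod_cast h
    exact ⟨_, h, h4, (Nat.le_self_pow hs _).trans h4, Or.inr h3, by
      linarith [Nat.lt_floor_add_one (t / 2)]⟩

lemma rpow_one_div_sq_inv_rpow {s : ℕ} (β : ℝ) (w : ℕ) :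
    ((((w : ℝ) ^ ((1 : ℝ) / s)) ^ 2)⁻¹) ^ β = (w : ℝ) ^ (-(2 * β) / s) := by
  have hw : (0 : ℝ) ≤ w := Nat.cast_nonneg w
  rw [← Real.rpow_natCast, ← Real.rpow_mul hw, Real.inv_rpow (by positivity), ← Real.rpow_mul hw,
    ← Real.rpow_neg hw]
  congr 1
  push_cast
  ring

/-- For a `β`-Hölder function `G : ℝ^s → ℝ` with constant `C₀`, there is a
constant `C > 0` depending only on `C₀, s, β` such that for every `m > 0` and positive integers
`w, d` there is a ReLU network `g : ℝ^p → ℝ` of width `3^{s+3} max{s⌊w^{1/s}⌋, w+1}` and depth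
`12d + 14 + 2s`, depending on `x` only through `x_{S₀}`, with
`sup_{x_{S₀} ∈ [−m,m]^s} |G(x_{S₀}) − g(x)| ≤ C m^β w^{−2β/s} d^{−2β/s}`. -/
theorem stmt10 (s : ℕ) (hs : 1 ≤ s) (β C₀ : ℝ) (hβ0 : 0 < β) (hβ1 : β ≤ 1) (hC₀ : 0 < C₀) :
    ∃ C : ℝ, 0 < C ∧
      ∀ (p : ℕ) (S₀ : Finset (Fin p)) (hcard : S₀.card = s)
        (G : (Fin s → ℝ) → ℝ),
        (∀ z z' : Fin s → ℝ, |G z - G z'| ≤ C₀ * euclNorm (z - z') ^ β) →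
        ∀ m : ℝ, 0 < m → ∀ w d : ℕ, 0 < w → 0 < d →
          ∃ g : (Fin p → ℝ) → ℝ,
            IsReluNet (3 ^ (s + 3) * max (s * ⌊(w : ℝ) ^ ((1 : ℝ) / s)⌋₊) (w + 1))
              (12 * d + 14 + 2 * s) g ∧
            (∀ x x' : Fin p → ℝ, subvec S₀ hcard x = subvec S₀ hcard x' → g x = g x') ∧
            ∀ x : Fin p → ℝ, (∀ i, |subvec S₀ hcard x i| ≤ m) →
              |G (subvec S₀ hcard x) - g x| ≤
                C * m ^ β * (w : ℝ) ^ (-(2 * β) / s) * (d : ℝ) ^ (-(2 * β) / s) := by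
  have hs0 : s ≠ 0 := by omega
  have hs' : (0 : ℝ) < s := by exact_mod_cast hs
  refine ⟨3 * C₀ * (512 * s) ^ β, by positivity, ?_⟩
  intro p S₀ hcard G hG m hm w d hw hd
  obtain ⟨hn, hnw, hn2⟩ := floor_rpow_one_div s hs0 hw
  obtain ⟨q, hq, hqd, hqd', hqT, hq2⟩ := exists_side_length s hs0 hd
  have hw1 := one_le_rpow_one_div s hw
  have hd1 := one_le_rpow_one_div s hd
  rw [← rpow_one_div_sq_inv_rpow β w, ← rpow_one_div_sq_inv_rpow β d]
  set n := ⌊(w : ℝ) ^ ((1 : ℝ) / s)⌋₊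
  set ω := (w : ℝ) ^ ((1 : ℝ) / s)
  set δ := (d : ℝ) ^ ((1 : ℝ) / s)
  set K : ℝ := ((n * (n * q * q) : ℕ) : ℝ) with hK
  have hK1 : 1 ≤ K := by
    rw [hK]
    exact_mod_cast Nat.succ_le_of_lt (by positivity : 0 < n * (n * q * q))
  have hK2 : ω ^ 2 * δ ^ 2 / 64 ≤ K := by
    calc ω ^ 2 * δ ^ 2 / 64 = (ω / 2) * ((ω / 2) * (δ / 4) * (δ / 4)) := by ring
      _ ≤ n * (n * q * q) := by gcongr
      _ = K := by rw [hK]; push_cast; ring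
  set h : ℝ := 2 * m / (K - 3 / 4) with hh
  have hKpos : 0 < K - 3 / 4 := by linarith
  have hpos : 0 < h := by positivity
  have hle : h ≤ 512 * m * ((ω ^ 2)⁻¹ * (δ ^ 2)⁻¹) := by
    rw [hh, div_le_iff₀ hKpos]
    have : ω ^ 2 * δ ^ 2 / 256 ≤ K - 3 / 4 := by linarith
    calc 2 * m = 512 * m * ((ω ^ 2)⁻¹ * (δ ^ 2)⁻¹) * (ω ^ 2 * δ ^ 2 / 256) := by
          field_simp; norm_num
      _ ≤ _ := by gcongr
  have hGle : ∀ z z' : Fin s → ℝ, (∀ i, |z i - z' i| ≤ h) → |G z - G z'| ≤ C₀ * (s * h) ^ β := by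
    intro z z' hz
    refine (hG z z').trans ?_
    gcongr
    · exact Real.sqrt_nonneg _
    · exact euclNorm_le hpos.le hz
  set F : (Fin s → ℕ) → ℝ := fun a => G fun i => ((a i : ℝ) - 1 / 4) * h - m with hF
  set W := 27 * max (s * n) (w + 1)
  obtain ⟨ψ, h1, h2⟩ := exists_layered_cube n q d hn hq hqT F (C₀ * (s * h) ^ β) (by positivity)
    (fun a b hab => hGle _ _ fun i => by
      have h3 : (a i : ℝ) ≤ b i + 1 := by exact_mod_cast (hab i).1
      have h4 : (b i : ℝ) ≤ a i + 1 := by exact_mod_cast (hab i).2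
      rw [abs_le]
      constructor <;> nlinarith) W (by omega) (by omega)
  set y : (Fin p → ℝ) → Fin s → ℝ := fun x i => h⁻¹ * subvec S₀ hcard x i + (h⁻¹ * m + 1 / 4)
  have h3 := h1.comp_affine y fun i => add_mem
    (Submodule.smul_mem _ h⁻¹ (subset_affSpan ⟨_, rfl⟩)) (const_mem_affSpan (h⁻¹ * m + 1 / 4))
  have hWs : 3 ^ (s + 3) * max (s * n) (w + 1) = 3 ^ s * W := by simp only [W]; ring
  have hs3 : 0 < 3 ^ s := by positivity
  have h4 := h3.pad (by nlinarith [show 2 ≤ W by omega])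
    (12 * d + 14 + 2 * s - (2 + 2 * q + 6 * q ^ s + 2 * d + 2 * s))
  rw [Nat.add_sub_of_le (by omega)] at h4
  refine ⟨ψ ∘ y, ?_, ?_, ?_⟩
  · rw [hWs]
    exact h4.isReluNet
  · intro x x' hx
    simp only [Function.comp_apply, y, hx]
  · intro x hx
    have hhm : h⁻¹ * (2 * m) = K - 3 / 4 := by rw [hh]; field_simp
    have hinv : 0 < h⁻¹ := inv_pos.2 hpos
    have h5 := h2 (y x) (G (subvec S₀ hcard x)) (fun i => by
      have := abs_le.1 (hx i)
      constructor <;> simp only [y] <;> nlinarith) (fun a ha => hGle _ _ fun i => by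
        have : ((a i : ℝ) - 1 / 4) * h - m - subvec S₀ hcard x i = (a i - y x i) * h := by
          simp only [y]; field_simp; ring
        rw [this, abs_mul, abs_of_pos hpos]
        nlinarith [ha i])
    rw [abs_sub_comm]
    calc |(ψ ∘ y) x - G (subvec S₀ hcard x)| ≤ 3 * (C₀ * (s * h) ^ β) := h5
      _ ≤ 3 * (C₀ * (s * (512 * m * ((ω ^ 2)⁻¹ * (δ ^ 2)⁻¹))) ^ β) := by gcongr
      _ = 3 * (C₀ * ((512 * s) * m * (ω ^ 2)⁻¹ * (δ ^ 2)⁻¹) ^ β) := by ring_nf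
      _ = _ := by
        rw [Real.mul_rpow (by positivity) (by positivity),
          Real.mul_rpow (by positivity) (by positivity),
          Real.mul_rpow (by positivity) (by positivity)]
        ring
end
end
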